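/- arXiv:1903.10990 — 6 statements merged into one kernel-verified Lean document; each statement's English description precedes it below -/
import Mathlib

section
/- Let n ≥ 3 and let U be the standard bubble. For l ∈ {1,…,n-1} set j_l := ∂U/∂y_l, and set jₙ := ∑_{b=1}^{n} y_b·∂U/∂y_b + ((n-2)/2)·U. Then for every b ∈ {1,…,n}, the function j_b is harmonic on the open upper half-space {yₙ > 0} and satisfies the linearized boundary condition ∂j_b/∂yₙ(z,0) + n·U(z,0)^{2/(n-2)}·j_b(z,0) = 0 for all z ∈ ℝ^{n-1}. -/
open MeasureTheory

noncomputable section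

/-- The index of the last coordinate in `Fin n`. -/
def lastIdx (n : ℕ) [NeZero n] : Fin n :=
  ⟨n - 1, Nat.sub_lt (Nat.pos_of_ne_zero (NeZero.ne n)) Nat.one_pos⟩

/-- The last coordinate `yₙ` of a point `y ∈ ℝⁿ`. -/
def lastCoord (n : ℕ) [NeZero n] (y : EuclideanSpace ℝ (Fin n)) : ℝ :=
  y (lastIdx n)

/-- `|ȳ|²`, the squared norm of the first `n-1` coordinates. -/
def barNormSq (n : ℕ) [NeZero n] (y : EuclideanSpace ℝ (Fin n)) : ℝ :=
  ∑ i : Fin n, if (i : ℕ) < n - 1 then (y i) ^ 2 else 0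

/-- The standard bubble `U(y) = ((1+yₙ)² + |ȳ|²)^(-(n-2)/2)`. -/
def bubble (n : ℕ) [NeZero n] (y : EuclideanSpace ℝ (Fin n)) : ℝ :=
  ((1 + lastCoord n y) ^ 2 + barNormSq n y) ^ (-((n : ℝ) - 2) / 2)

/-- The partial derivative `∂f/∂yᵢ`. -/
def partialDeriv (n : ℕ) (f : EuclideanSpace ℝ (Fin n) → ℝ) (i : Fin n)
    (y : EuclideanSpace ℝ (Fin n)) : ℝ :=
  fderiv ℝ f y (EuclideanSpace.single i 1)

/-- The functions `j_b` generating the kernel of the linearized problem: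
`j_l = ∂U/∂y_l` for `l = 1,…,n-1` and `jₙ = ∑_b y_b ∂U/∂y_b + (n-2)/2 U`. -/
def jfun (n : ℕ) [NeZero n] (b : Fin n) (y : EuclideanSpace ℝ (Fin n)) : ℝ :=
  if (b : ℕ) < n - 1 then partialDeriv n (bubble n) b y
  else ∑ a : Fin n, y a * partialDeriv n (bubble n) a y + ((n : ℝ) - 2) / 2 * bubble n y

open Filter Topology

/-- Shifted coordinates. -/
def wc (n : ℕ) [NeZero n] (i : Fin n) (y : EuclideanSpace ℝ (Fin n)) : ℝ :=
  y i + if i = lastIdx n then 1 else 0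

/-- Sum of squares of shifted coordinates. -/
def QQ (n : ℕ) [NeZero n] (y : EuclideanSpace ℝ (Fin n)) : ℝ := ∑ i, wc n i y ^ 2

/-- Differentiability with a prescribed partial derivative. -/
def HasPD (n : ℕ) (f : EuclideanSpace ℝ (Fin n) → ℝ) (d : ℝ) (i : Fin n)
    (y : EuclideanSpace ℝ (Fin n)) : Prop :=
  ∃ L : EuclideanSpace ℝ (Fin n) →L[ℝ] ℝ, HasFDerivAt f L y ∧ L (EuclideanSpace.single i 1) = d

theorem HasPD.eq {n : ℕ} {f : EuclideanSpace ℝ (Fin n) → ℝ} {d : ℝ} {i : Fin n}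
    {y : EuclideanSpace ℝ (Fin n)} (h : HasPD n f d i y) : partialDeriv n f i y = d := by
  obtain ⟨L, hL, hd⟩ := h
  rw [partialDeriv, hL.fderiv, hd]

theorem HasPD.mul {n : ℕ} {f g : EuclideanSpace ℝ (Fin n) → ℝ} {d e : ℝ} {i : Fin n}
    {y : EuclideanSpace ℝ (Fin n)} (h : HasPD n f d i y) (k : HasPD n g e i y) :
    HasPD n (fun y => f y * g y) (f y * e + g y * d) i y := by
  obtain ⟨L, hL, hd⟩ := h
  obtain ⟨M, hM, he⟩ := k
  exact ⟨_, hL.mul hM, by simp [hd, he]⟩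

theorem HasPD.add {n : ℕ} {f g : EuclideanSpace ℝ (Fin n) → ℝ} {d e : ℝ} {i : Fin n}
    {y : EuclideanSpace ℝ (Fin n)} (h : HasPD n f d i y) (k : HasPD n g e i y) :
    HasPD n (fun y => f y + g y) (d + e) i y := by
  obtain ⟨L, hL, hd⟩ := h
  obtain ⟨M, hM, he⟩ := k
  exact ⟨_, hL.add hM, by simp [hd, he]⟩

theorem HasPD.cmul {n : ℕ} {f : EuclideanSpace ℝ (Fin n) → ℝ} {d : ℝ} {i : Fin n}
    {y : EuclideanSpace ℝ (Fin n)} (h : HasPD n f d i y) (c : ℝ) :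
    HasPD n (fun y => c * f y) (c * d) i y := by
  obtain ⟨L, hL, hd⟩ := h
  exact ⟨_, hL.const_mul c, by simp [hd]⟩

theorem hasPD_wc (n : ℕ) [NeZero n] (i b : Fin n) (y : EuclideanSpace ℝ (Fin n)) :
    HasPD n (wc n b) (if i = b then 1 else 0) i y := by
  refine ⟨EuclideanSpace.proj b,
    ((EuclideanSpace.proj b : EuclideanSpace ℝ (Fin n) →L[ℝ] ℝ).hasFDerivAt).add_const _, ?_⟩
  simp [Pi.single_apply, eq_comm]

theorem hasPD_QQ (n : ℕ) [NeZero n] (i : Fin n) (y : EuclideanSpace ℝ (Fin n)) :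
    HasPD n (QQ n) (2 * wc n i y) i y := by
  choose L hL hd using fun b => hasPD_wc n i b y
  refine ⟨_, HasFDerivAt.fun_sum (fun b _ => (hL b).pow 2), ?_⟩
  simp [hd]

theorem hasPD_pow (n : ℕ) [NeZero n] (i : Fin n) (y : EuclideanSpace ℝ (Fin n)) (s : ℝ)
    (hy : 0 < QQ n y) :
    HasPD n (fun y => QQ n y ^ s) (2 * s * wc n i y * QQ n y ^ (s - 1)) i y := by
  obtain ⟨L, hL, hd⟩ := hasPD_QQ n i y
  refine ⟨_, hL.rpow_const (Or.inl hy.ne'), ?_⟩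
  simp [hd]; ring

theorem partialDeriv_congr {n : ℕ} {f g : EuclideanSpace ℝ (Fin n) → ℝ} {i : Fin n}
    {y : EuclideanSpace ℝ (Fin n)} (h : f =ᶠ[𝓝 y] g) :
    partialDeriv n f i y = partialDeriv n g i y := by
  rw [partialDeriv, partialDeriv, h.fderiv_eq]

theorem QQ_ev (n : ℕ) [NeZero n] (y : EuclideanSpace ℝ (Fin n)) (hy : 0 < QQ n y) :
    ∀ᶠ x in 𝓝 y, 0 < QQ n x := by
  obtain ⟨L, hL, -⟩ := hasPD_QQ n (lastIdx n) y
  exact hL.continuousAt.eventually (lt_mem_nhds hy)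

theorem QQ_pos (n : ℕ) [NeZero n] (y : EuclideanSpace ℝ (Fin n)) (hy : 0 ≤ lastCoord n y) :
    0 < QQ n y := by
  refine Finset.sum_pos' (fun i _ => sq_nonneg _) ⟨lastIdx n, Finset.mem_univ _, ?_⟩
  have : 0 < wc n (lastIdx n) y := by
    simp only [wc, if_true]; unfold lastCoord at hy; linarith
  positivity

theorem lt_iff_ne_last (n : ℕ) [NeZero n] (i : Fin n) : (i : ℕ) < n - 1 ↔ i ≠ lastIdx n := by
  have := i.2
  rw [ne_eq, Fin.ext_iff]
  simp only [lastIdx]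
  omega

theorem bubble_eq (n : ℕ) [NeZero n] (y : EuclideanSpace ℝ (Fin n)) :
    bubble n y = QQ n y ^ (-(n : ℝ) / 2 + 1) := by
  have h : (1 + lastCoord n y) ^ 2 + barNormSq n y = QQ n y := by
    have h1 : (1 + lastCoord n y) ^ 2
        = ∑ i : Fin n, if i = lastIdx n then (1 + y i) ^ 2 else 0 := by
      simp [lastCoord]
    rw [h1, barNormSq, QQ, ← Finset.sum_add_distrib]
    refine Finset.sum_congr rfl fun i _ => ?_
    by_cases hi : i = lastIdx n
    · simp only [lt_iff_ne_last, wc, hi]; simp; ring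
    · simp [lt_iff_ne_last, wc, hi]
  rw [bubble, h]
  congr 1; ring

/-- Common form of the functions. -/
def FF (n : ℕ) [NeZero n] (b : Fin n) (α β : ℝ) (y : EuclideanSpace ℝ (Fin n)) : ℝ :=
  α * (wc n b y * QQ n y ^ (-(n : ℝ) / 2)) + β * QQ n y ^ (-(n : ℝ) / 2 + 1)

theorem pd_bubble (n : ℕ) [NeZero n] (a : Fin n) (y : EuclideanSpace ℝ (Fin n))
    (hy : 0 < QQ n y) :
    partialDeriv n (bubble n) a y
      = 2 * (-(n : ℝ) / 2 + 1) * wc n a y * QQ n y ^ (-(n : ℝ) / 2) := by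
  have h : bubble n = fun y => QQ n y ^ (-(n : ℝ) / 2 + 1) := funext (bubble_eq n)
  rw [h, (hasPD_pow n a y _ hy).eq]
  congr 2; ring

theorem jfun_eq (n : ℕ) [NeZero n] (b : Fin n) : ∃ α β : ℝ,
    (∀ y, 0 < QQ n y → jfun n b y = FF n b α β y) ∧
    ((b ≠ lastIdx n ∧ β = 0) ∨ (b = lastIdx n ∧ α + 2 * β = 0)) := by
  by_cases hb : b = lastIdx n
  · refine ⟨(n : ℝ) - 2, -(((n : ℝ) - 2) / 2), fun y hy => ?_, Or.inr ⟨hb, by ring⟩⟩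
    have h0 : ¬ ((b : ℕ) < n - 1) := by rw [lt_iff_ne_last]; simp [hb]
    rw [jfun, if_neg h0, FF, bubble_eq]
    have h1 : ∑ a : Fin n, y a * partialDeriv n (bubble n) a y
        = 2 * (-(n : ℝ) / 2 + 1) * QQ n y ^ (-(n : ℝ) / 2) * ∑ a, y a * wc n a y := by
      rw [Finset.mul_sum]
      refine Finset.sum_congr rfl fun a _ => ?_
      rw [pd_bubble n a y hy]; ring
    have h2 : ∑ a, y a * wc n a y = QQ n y - wc n b y := by
      have : wc n b y = ∑ a, if a = lastIdx n then wc n a y else 0 := by simp [hb]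
      rw [this, QQ, ← Finset.sum_sub_distrib]
      refine Finset.sum_congr rfl fun a _ => ?_
      by_cases ha : a = lastIdx n <;> simp [wc, ha] <;> ring
    rw [h1, h2, Real.rpow_add_one hy.ne']
    ring
  · refine ⟨2 * (-(n : ℝ) / 2 + 1), 0, fun y hy => ?_, Or.inl ⟨hb, rfl⟩⟩
    rw [jfun, if_pos ((lt_iff_ne_last n b).2 hb), pd_bubble n b y hy, FF]
    ring

theorem pd_FF (n : ℕ) [NeZero n] (b i : Fin n) (α β : ℝ) (y : EuclideanSpace ℝ (Fin n))
    (hy : 0 < QQ n y) :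
    partialDeriv n (FF n b α β) i y
      = α * ((if i = b then 1 else 0) * QQ n y ^ (-(n : ℝ) / 2))
        + (-(n : ℝ) * α) * (wc n b y * (wc n i y * QQ n y ^ (-(n : ℝ) / 2 - 1)))
        + (2 * β * (-(n : ℝ) / 2 + 1)) * (wc n i y * QQ n y ^ (-(n : ℝ) / 2)) := by
  have h := ((((hasPD_wc n i b y).mul (hasPD_pow n i y (-(n : ℝ) / 2) hy)).cmul α).add
    ((hasPD_pow n i y (-(n : ℝ) / 2 + 1) hy).cmul β)).eq
  refine Eq.trans h ?_
  rw [show -(n : ℝ) / 2 + 1 - 1 = -(n : ℝ) / 2 by ring]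
  ring

theorem pd2_FF (n : ℕ) [NeZero n] (b i : Fin n) (α β : ℝ) (y : EuclideanSpace ℝ (Fin n))
    (hy : 0 < QQ n y) :
    partialDeriv n (partialDeriv n (FF n b α β) i) i y
      = (if i = b then 1 else 0) * (-2 * n * α * wc n i y * QQ n y ^ (-(n : ℝ) / 2 - 1))
        + (-(n : ℝ) * α * wc n b y * QQ n y ^ (-(n : ℝ) / 2 - 1)
          + 2 * β * (-(n : ℝ) / 2 + 1) * QQ n y ^ (-(n : ℝ) / 2))
        + wc n i y ^ 2 * (n * α * (n + 2) * wc n b y * QQ n y ^ (-(n : ℝ) / 2 - 2)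
          - 2 * n * β * (-(n : ℝ) / 2 + 1) * QQ n y ^ (-(n : ℝ) / 2 - 1)) := by
  have hc := partialDeriv_congr (i := i)
    ((QQ_ev n y hy).mono fun x hx => pd_FF n b i α β x hx)
  rw [hc]
  have h := ((((((hasPD_pow n i y (-(n : ℝ) / 2) hy).cmul (if i = b then 1 else 0)).cmul α).add
    (((hasPD_wc n i b y).mul ((hasPD_wc n i i y).mul
      (hasPD_pow n i y (-(n : ℝ) / 2 - 1) hy))).cmul (-(n : ℝ) * α))).add
    (((hasPD_wc n i i y).mul (hasPD_pow n i y (-(n : ℝ) / 2) hy)).cmul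
      (2 * β * (-(n : ℝ) / 2 + 1))))).eq
  refine Eq.trans h ?_
  rw [show -(n : ℝ) / 2 - 1 - 1 = -(n : ℝ) / 2 - 2 by ring, if_pos (rfl : i = i)]
  ring

/-- Each `j_b` is harmonic on the open upper half-space and satisfies the linearized
boundary condition `∂j_b/∂yₙ + n U^{2/(n-2)} j_b = 0` on `{yₙ = 0}`. -/
theorem statement2 (n : ℕ) [NeZero n] (hn : 3 ≤ n) :
    ∀ b : Fin n,
      (∀ y : EuclideanSpace ℝ (Fin n), 0 < lastCoord n y →
          ∑ i : Fin n, partialDeriv n (partialDeriv n (jfun n b) i) i y = 0) ∧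
      (∀ z : EuclideanSpace ℝ (Fin n), lastCoord n z = 0 →
          partialDeriv n (jfun n b) (lastIdx n) z
            + (n : ℝ) * bubble n z ^ (2 / ((n : ℝ) - 2)) * jfun n b z = 0) := by
  intro b
  obtain ⟨α, β, hj, hab⟩ := jfun_eq n b
  have hev : ∀ y, 0 < QQ n y → jfun n b =ᶠ[𝓝 y] FF n b α β :=
    fun y hy => (QQ_ev n y hy).mono fun x hx => hj x hx
  constructor
  · intro y hy
    have hQ := QQ_pos n y hy.le
    have h1 : ∀ i, partialDeriv n (partialDeriv n (jfun n b) i) i y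
        = partialDeriv n (partialDeriv n (FF n b α β) i) i y := fun i =>
      partialDeriv_congr ((QQ_ev n y hQ).mono fun x hx => partialDeriv_congr (hev x hx))
    simp only [h1, pd2_FF n b _ α β y hQ]
    rw [Finset.sum_add_distrib, Finset.sum_add_distrib, ← Finset.sum_mul]
    have hs : ∑ i, wc n i y ^ 2 = QQ n y := rfl
    rw [hs]
    have e1 : QQ n y ^ (-(n : ℝ) / 2 - 1) = QQ n y ^ (-(n : ℝ) / 2 - 2) * QQ n y := by
      rw [← Real.rpow_add_one hQ.ne']; congr 1; ring
    have e2 : QQ n y ^ (-(n : ℝ) / 2) = QQ n y ^ (-(n : ℝ) / 2 - 2) * QQ n y * QQ n y := by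
      rw [← Real.rpow_add_one hQ.ne', ← Real.rpow_add_one hQ.ne']; congr 1; ring
    rw [e1, e2]
    simp only [ite_mul, one_mul, zero_mul, Finset.sum_ite_eq', Finset.mem_univ, if_true,
      Finset.sum_const, Finset.card_univ, Fintype.card_fin, nsmul_eq_mul]
    ring
  · intro z hz
    have hQ := QQ_pos n z hz.ge
    have hn' : (n : ℝ) - 2 ≠ 0 := by
      have : (3 : ℝ) ≤ n := by exact_mod_cast hn
      linarith
    have hU : bubble n z ^ (2 / ((n : ℝ) - 2)) = QQ n z ^ (-1 : ℝ) := by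
      rw [bubble_eq, ← Real.rpow_mul hQ.le]
      congr 1; field_simp; ring
    have hw : wc n (lastIdx n) z = 1 := by
      unfold lastCoord at hz
      simp [wc, hz]
    rw [partialDeriv_congr (hev z hQ), pd_FF n b _ α β z hQ, hj z hQ, hU, FF, hw,
      Real.rpow_neg_one, Real.rpow_sub_one hQ.ne', Real.rpow_add_one hQ.ne']
    rcases hab with ⟨hb, rfl⟩ | ⟨hb, hab⟩
    · rw [if_neg (Ne.symm hb)]
      field_simp
      ring
    · rw [if_pos hb.symm, hb, hw]
      obtain rfl : α = -2 * β := by linarith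
      field_simp
      ring
end
end

section
/- Let n ≥ 3, let U be the standard bubble and jₙ := ∑_{b=1}^{n} y_b·∂U/∂y_b + ((n-2)/2)·U. Then ∫_{ℝ^{n-1}} jₙ(z,0)·log U(z,0)·U(z,0)^{n/(n-2)} dz = -σ_{n-2}·((n-2)²/4)·∫₀^∞ (1-r²)·r^{n-2}·log(1+r²)·(1+r²)^{-n} dr, and this quantity is strictly positive; equivalently ∫₀^∞ (1-r²)·r^{n-2}·log(1+r²)·(1+r²)^{-n} dr < 0. -/
open MeasureTheory

noncomputable section

/-- The surface measure of the unit sphere `S^{d-1} ⊂ ℝ^d`, expressed as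
`d · vol(B₁^d)`. For `d = n-1` this is `σ_{n-2}`, the area of `S^{n-2} ⊂ ℝ^{n-1}`. -/
def sphereArea (d : ℕ) : ℝ :=
  (d : ℝ) * (volume (Metric.ball (0 : EuclideanSpace ℝ (Fin d)) 1)).toReal

/-- log bound -/
lemma aux_log (r : ℝ) (hr : 0 < r) : r * Real.log (1 + r ^ 2) ≤ 2 * (1 + r ^ 2) := by
  have h1 : Real.log (1 + r ^ 2) ≤ 2 * r := by
    have h2 : Real.log (1 + r ^ 2) ≤ Real.log ((1 + r) ^ 2) :=
      Real.log_le_log (by positivity) (by nlinarith)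
    have h3 := Real.log_le_sub_one_of_pos (show 0 < 1 + r by linarith)
    rw [Real.log_pow] at h2
    push_cast at h2
    linarith
  nlinarith

lemma aux_int (m : ℕ) (g : ℝ → ℝ) (hg : Measurable g) (C : ℝ)
    (hC : ∀ r : ℝ, 0 < r → r * |g r| ≤ C * (1 + r ^ 2)) :
    IntegrableOn (fun r : ℝ => (1 - r ^ 2) * r ^ (m + 1) * g r / (1 + r ^ 2) ^ (m + 3))
      (Set.Ioi 0) := by
  have h0 : Integrable (fun r : ℝ => C * (1 + r ^ 2)⁻¹) (volume.restrict (Set.Ioi 0)) :=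
    (integrable_inv_one_add_sq.const_mul C).integrableOn
  refine h0.mono' ?_ ?_
  · exact (by fun_prop : Measurable _).aestronglyMeasurable
  · refine (ae_restrict_iff' measurableSet_Ioi).2 (Filter.Eventually.of_forall fun r hr => ?_)
    have hr : 0 < r := hr
    have hp : 0 < 1 + r ^ 2 := by positivity
    rw [Real.norm_eq_abs, abs_div, abs_mul, abs_mul, abs_of_pos (pow_pos hr _),
      abs_of_pos (pow_pos hp _), div_le_iff₀ (by positivity)]
    have e : C * (1 + r ^ 2)⁻¹ * (1 + r ^ 2) ^ (m + 3)
        = (1 + r ^ 2) * (1 + r ^ 2) ^ m * (C * (1 + r ^ 2)) := by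
      field_simp
      ring
    rw [e]
    have h1 : |1 - r ^ 2| ≤ 1 + r ^ 2 := by
      rw [abs_le]; constructor <;> nlinarith
    have h2 : r ^ m ≤ (1 + r ^ 2) ^ m := pow_le_pow_left₀ hr.le (by nlinarith) m
    calc |1 - r ^ 2| * r ^ (m + 1) * |g r| = |1 - r ^ 2| * r ^ m * (r * |g r|) := by ring
      _ ≤ _ := by
        exact mul_le_mul (mul_le_mul h1 h2 (by positivity) hp.le) (hC r hr) (by positivity)
          (by positivity)

lemma aux_zero (m : ℕ) :
    ∫ r in Set.Ioi (0 : ℝ), (1 - r ^ 2) * r ^ (m + 1) * 1 / (1 + r ^ 2) ^ (m + 3) = 0 := by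
  have hi := aux_int m (fun _ => 1) measurable_const 1 (fun r hr => by
    simp; nlinarith [sq_nonneg (r - 1)])
  have hd : ∀ x ∈ Set.Ici (0 : ℝ), HasDerivAt
      (fun r : ℝ => (r / (1 + r ^ 2)) ^ (m + 2) / (m + 2))
      ((1 - x ^ 2) * x ^ (m + 1) * 1 / (1 + x ^ 2) ^ (m + 3)) x := by
    intro x _
    have hp : 1 + x ^ 2 ≠ 0 := by positivity
    have hm : (m : ℝ) + 2 ≠ 0 := by positivity
    have h1 : HasDerivAt (fun r : ℝ => 1 + r ^ 2) (2 * x) x := by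
      simpa using (hasDerivAt_pow 2 x).const_add 1
    have h2 := (((hasDerivAt_id x).div h1 hp).pow (m + 2)).div_const ((m : ℝ) + 2)
    refine HasDerivAt.congr_deriv (f := fun r : ℝ => (r / (1 + r ^ 2)) ^ (m + 2) / (m + 2)) h2 ?_
    rw [show m + 2 - 1 = m + 1 from rfl]
    simp only [Pi.div_apply, id]
    push_cast
    rw [div_pow]
    field_simp
    ring
  have ht : Filter.Tendsto (fun r : ℝ => (r / (1 + r ^ 2)) ^ (m + 2) / ((m : ℝ) + 2))
      Filter.atTop (nhds 0) := by
    have h3 : Filter.Tendsto (fun r : ℝ => r / (1 + r ^ 2)) Filter.atTop (nhds 0) := by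
      refine squeeze_zero' ?_ ?_ tendsto_inv_atTop_zero
      · filter_upwards [Filter.eventually_gt_atTop 0] with r hr
        positivity
      · filter_upwards [Filter.eventually_gt_atTop 0] with r hr
        rw [div_le_iff₀ (by positivity)]
        field_simp
        linarith
    simpa using (h3.pow (m + 2)).div_const ((m : ℝ) + 2)
  rw [integral_Ioi_of_hasDerivAt_of_tendsto' hd hi ht]
  simp

lemma aux_neg (m : ℕ) :
    ∫ r in Set.Ioi (0 : ℝ),
      (1 - r ^ 2) * r ^ (m + 1) * Real.log (1 + r ^ 2) / (1 + r ^ 2) ^ (m + 3) < 0 := by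
  have hi1 := aux_int m (fun _ => 1) measurable_const 1 (fun r hr => by
    simp; nlinarith [sq_nonneg (r - 1)])
  have hi2 := aux_int m (fun r => Real.log (1 + r ^ 2)) (by fun_prop) 2 (fun r hr => by
    rw [abs_of_nonneg (Real.log_nonneg (by nlinarith))]
    exact aux_log r hr)
  have hi3 : IntegrableOn (fun r : ℝ =>
      (Real.log 2 * ((1 - r ^ 2) * r ^ (m + 1) * 1 / (1 + r ^ 2) ^ (m + 3))
        - (1 - r ^ 2) * r ^ (m + 1) * Real.log (1 + r ^ 2) / (1 + r ^ 2) ^ (m + 3)))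
      (Set.Ioi 0) := (hi1.const_mul (Real.log 2)).sub hi2
  have hpos : 0 < ∫ r in Set.Ioi (0 : ℝ),
      (Real.log 2 * ((1 - r ^ 2) * r ^ (m + 1) * 1 / (1 + r ^ 2) ^ (m + 3))
        - (1 - r ^ 2) * r ^ (m + 1) * Real.log (1 + r ^ 2) / (1 + r ^ 2) ^ (m + 3)) := by
    have key : ∀ r : ℝ,
      (Real.log 2 * ((1 - r ^ 2) * r ^ (m + 1) * 1 / (1 + r ^ 2) ^ (m + 3))
        - (1 - r ^ 2) * r ^ (m + 1) * Real.log (1 + r ^ 2) / (1 + r ^ 2) ^ (m + 3))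
      = ((1 - r ^ 2) * (Real.log 2 - Real.log (1 + r ^ 2))) *
          (r ^ (m + 1) / (1 + r ^ 2) ^ (m + 3)) := by
      intro r; ring
    rw [setIntegral_pos_iff_support_of_nonneg_ae ?_ hi3]
    · refine lt_of_lt_of_le (b := volume (Set.Ioo (0 : ℝ) 1)) (by simp) (measure_mono ?_)
      rintro r ⟨h0, h1⟩
      refine ⟨?_, h0⟩
      rw [Function.mem_support, key]
      have : Real.log (1 + r ^ 2) < Real.log 2 :=
        Real.log_lt_log (by positivity) (by nlinarith)
      have h4 : 0 < 1 - r ^ 2 := by nlinarith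
      have h5 : 0 < Real.log 2 - Real.log (1 + r ^ 2) := by linarith
      positivity
    · refine (ae_restrict_iff' measurableSet_Ioi).2 (Filter.Eventually.of_forall fun r hr => ?_)
      have hr : 0 < r := hr
      simp only [Pi.zero_apply]
      rw [key]
      refine mul_nonneg ?_ (by positivity)
      rcases le_total (r ^ 2) 1 with h | h
      · have : Real.log (1 + r ^ 2) ≤ Real.log 2 :=
          Real.log_le_log (by positivity) (by linarith)
        exact mul_nonneg (by linarith) (by linarith)
      · have : Real.log 2 ≤ Real.log (1 + r ^ 2) :=
          Real.log_le_log (by positivity) (by linarith)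
        exact mul_nonneg_of_nonpos_of_nonpos (by linarith) (by linarith)
  rw [integral_sub (hi1.const_mul (Real.log 2)) hi2, integral_const_mul, aux_zero] at hpos
  linarith

lemma aux_sphere (d : ℕ) (hd : 0 < d) : 0 < sphereArea d := by
  unfold sphereArea
  have : 0 < (volume (Metric.ball (0 : EuclideanSpace ℝ (Fin d)) 1)).toReal :=
    ENNReal.toReal_pos (Metric.measure_ball_pos _ _ one_pos).ne' measure_ball_lt_top.ne
  positivity

lemma aux_eq (m : ℕ) :
    (∫ z : EuclideanSpace ℝ (Fin (m + 2)),
        (-((((m + 3 : ℕ) : ℝ) - 2) / 2) * (‖z‖ ^ 2 - 1) * (1 + ‖z‖ ^ 2) ^ (-((m + 3 : ℕ) : ℝ) / 2))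
          * Real.log ((1 + ‖z‖ ^ 2) ^ (-(((m + 3 : ℕ) : ℝ) - 2) / 2))
          * ((1 + ‖z‖ ^ 2) ^ (-(((m + 3 : ℕ) : ℝ) - 2) / 2)) ^ (((m + 3 : ℕ) : ℝ) / (((m + 3 : ℕ) : ℝ) - 2))
      = -sphereArea (m + 2) * ((((m + 3 : ℕ) : ℝ) - 2) ^ 2 / 4)
          * ∫ r in Set.Ioi (0 : ℝ),
              (1 - r ^ 2) * r ^ (m + 1) * Real.log (1 + r ^ 2) / (1 + r ^ 2) ^ (m + 3)) := by
  have h := integral_fun_norm_addHaar (volume : Measure (EuclideanSpace ℝ (Fin (m + 2))))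
    (fun t : ℝ => -((((m + 3 : ℕ) : ℝ) - 2) ^ 2 / 4) *
      ((1 - t ^ 2) * Real.log (1 + t ^ 2) / (1 + t ^ 2) ^ (m + 3)))
  have hz : ∀ z : EuclideanSpace ℝ (Fin (m + 2)),
        (-((((m + 3 : ℕ) : ℝ) - 2) / 2) * (‖z‖ ^ 2 - 1) * (1 + ‖z‖ ^ 2) ^ (-((m + 3 : ℕ) : ℝ) / 2))
          * Real.log ((1 + ‖z‖ ^ 2) ^ (-(((m + 3 : ℕ) : ℝ) - 2) / 2))
          * ((1 + ‖z‖ ^ 2) ^ (-(((m + 3 : ℕ) : ℝ) - 2) / 2)) ^ (((m + 3 : ℕ) : ℝ) / (((m + 3 : ℕ) : ℝ) - 2))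
        = -((((m + 3 : ℕ) : ℝ) - 2) ^ 2 / 4) *
      ((1 - ‖z‖ ^ 2) * Real.log (1 + ‖z‖ ^ 2) / (1 + ‖z‖ ^ 2) ^ (m + 3)) := by
    intro z
    have hp : 0 < 1 + ‖z‖ ^ 2 := by positivity
    have hn2 : ((m + 3 : ℕ) : ℝ) - 2 ≠ 0 := by
      have : (0 : ℝ) ≤ m := by positivity
      have h3 : (m : ℝ) + 3 - 2 = m + 1 := by ring
      push_cast
      rw [h3]
      positivity
    rw [← Real.rpow_mul hp.le, Real.log_rpow hp]
    have e1 : -(((m + 3 : ℕ) : ℝ) - 2) / 2 * (((m + 3 : ℕ) : ℝ) / (((m + 3 : ℕ) : ℝ) - 2))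
        = -((m + 3 : ℕ) : ℝ) / 2 := by field_simp
    rw [e1]
    have e2 : (1 + ‖z‖ ^ 2) ^ (-((m + 3 : ℕ) : ℝ) / 2) * (1 + ‖z‖ ^ 2) ^ (-((m + 3 : ℕ) : ℝ) / 2)
        = ((1 + ‖z‖ ^ 2) ^ (m + 3))⁻¹ := by
      rw [← Real.rpow_add hp, ← Real.rpow_natCast _ (m + 3), ← Real.rpow_neg hp.le]
      congr 1; ring
    rw [div_eq_mul_inv _ ((1 + ‖z‖ ^ 2) ^ (m + 3)), ← e2]
    ring
  simp_rw [hz]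
  rw [h, finrank_euclideanSpace_fin]
  have hr : ∀ r : ℝ, r ^ (m + 2 - 1) • (-((((m + 3 : ℕ) : ℝ) - 2) ^ 2 / 4) *
      ((1 - r ^ 2) * Real.log (1 + r ^ 2) / (1 + r ^ 2) ^ (m + 3)))
      = -((((m + 3 : ℕ) : ℝ) - 2) ^ 2 / 4) *
        ((1 - r ^ 2) * r ^ (m + 1) * Real.log (1 + r ^ 2) / (1 + r ^ 2) ^ (m + 3)) := by
    intro r
    rw [show m + 2 - 1 = m + 1 from rfl, smul_eq_mul]
    ring
  simp_rw [hr]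
  rw [integral_const_mul]
  simp only [sphereArea, nsmul_eq_mul, smul_eq_mul, Measure.real]
  ring

/-- With `U(z,0) = (1+|z|²)^{-(n-2)/2}` and `jₙ(z,0) = -((n-2)/2)(|z|²-1)(1+|z|²)^{-n/2}`,
one has `∫_{ℝ^{n-1}} jₙ(z,0) log U(z,0) U(z,0)^{n/(n-2)} dz
 = -σ_{n-2} ((n-2)²/4) ∫₀^∞ (1-r²) r^{n-2} log(1+r²) (1+r²)^{-n} dr > 0`;
equivalently the radial integral is negative. -/
theorem statement4 (n : ℕ) (hn : 3 ≤ n) :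
    (∫ z : EuclideanSpace ℝ (Fin (n - 1)),
        (-(((n : ℝ) - 2) / 2) * (‖z‖ ^ 2 - 1) * (1 + ‖z‖ ^ 2) ^ (-(n : ℝ) / 2))
          * Real.log ((1 + ‖z‖ ^ 2) ^ (-((n : ℝ) - 2) / 2))
          * ((1 + ‖z‖ ^ 2) ^ (-((n : ℝ) - 2) / 2)) ^ ((n : ℝ) / ((n : ℝ) - 2))
      = -sphereArea (n - 1) * (((n : ℝ) - 2) ^ 2 / 4)
          * ∫ r in Set.Ioi (0 : ℝ),
              (1 - r ^ 2) * r ^ (n - 2) * Real.log (1 + r ^ 2) / (1 + r ^ 2) ^ n) ∧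
    (0 < ∫ z : EuclideanSpace ℝ (Fin (n - 1)),
        (-(((n : ℝ) - 2) / 2) * (‖z‖ ^ 2 - 1) * (1 + ‖z‖ ^ 2) ^ (-(n : ℝ) / 2))
          * Real.log ((1 + ‖z‖ ^ 2) ^ (-((n : ℝ) - 2) / 2))
          * ((1 + ‖z‖ ^ 2) ^ (-((n : ℝ) - 2) / 2)) ^ ((n : ℝ) / ((n : ℝ) - 2))) ∧
    (∫ r in Set.Ioi (0 : ℝ),
        (1 - r ^ 2) * r ^ (n - 2) * Real.log (1 + r ^ 2) / (1 + r ^ 2) ^ n < 0) := by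
  obtain ⟨m, rfl⟩ := Nat.exists_eq_add_of_le' hn
  have h1 := aux_eq m
  have h2 := aux_neg m
  refine ⟨h1, ?_, h2⟩
  refine lt_of_lt_of_eq ?_ h1.symm
  have h3 := aux_sphere (m + 2) (by omega)
  have h4 : (0 : ℝ) < (((m + 3 : ℕ) : ℝ) - 2) ^ 2 / 4 := by
    have h5 : ((m + 3 : ℕ) : ℝ) - 2 = m + 1 := by push_cast; ring
    rw [h5]
    positivity
  rw [neg_mul, neg_mul, ← mul_neg]
  exact mul_pos (mul_pos h3 h4) (by linarith)
end
end

section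
/- Let m, k ≥ 1 and let α, β be natural numbers with 0 < β < α < m. Embed ℝ^m into ℝ^{m+k} as the subspace of vectors whose last k coordinates vanish. Then there exists a constant C > 0, depending only on m, k, α, β, such that for every y ∈ ℝ^{m+k} one has ∫_{ℝ^m} |ξ - y|^{β-m}·(1 + |ξ|)^{-α} dξ ≤ C·(1 + |y|)^{β-α}, where |ξ - y| is the Euclidean distance in ℝ^{m+k}. -/
open MeasureTheory

noncomputable section

/-- The embedding of `ℝ^m` into `ℝ^{m+k}` as the subspace of vectors whose last `k`
coordinates vanish. -/
def embSub (m k : ℕ) (ξ : EuclideanSpace ℝ (Fin m)) : EuclideanSpace ℝ (Fin (m + k)) :=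
  (EuclideanSpace.equiv (Fin (m + k)) ℝ).symm fun i =>
    if h : (i : ℕ) < m then ξ ⟨i, h⟩ else 0

theorem ptw (p a s Y x d e : ℝ) (hp : 0 < p) (ha : 0 < a) (hY : 0 ≤ Y) (hs : s = 1 + Y) (hx : 0 < x)
   (he : 0 < e) (hed : e ≤ d) (h1 : Y - x ≤ d) (h2 : x - Y ≤ d) :
   d ^ (-p) * (1 + x) ^ (-a) ≤ s ^ (-(p+a)) * (4 ^ a * (if e / s < 3 then (e/s) ^ (-p) else 0)
     + 4 ^ p * (if x / s < 3 then (x/s) ^ (-a) else 0) + 3 ^ (p+a) * (1 + x/s) ^ (-(p+a))) := by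
  have hs0 : 0 < s := by linarith
  have hd : 0 < d := by linarith
  have hA : 0 ≤ (4:ℝ) ^ a * (if e / s < 3 then (e/s) ^ (-p) else 0) := by
    split_ifs <;> positivity
  have hB : 0 ≤ (4:ℝ) ^ p * (if x / s < 3 then (x/s) ^ (-a) else 0) := by
    split_ifs <;> positivity
  have hC : 0 ≤ (3:ℝ) ^ (p+a) * (1 + x/s) ^ (-(p+a)) := by positivity
  have hS : 0 ≤ s ^ (-(p+a)) := by positivity
  have mono : ∀ u v q : ℝ, 0 < u → u ≤ v → 0 < q → v ^ (-q) ≤ u ^ (-q) := fun u v q hu huv hq =>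
    Real.rpow_le_rpow_of_nonpos hu huv (by linarith)
  rcases lt_or_ge d (s/4) with h | h
  · have : d ^ (-p) * (1 + x) ^ (-a) ≤ s ^ (-(p+a)) * (4 ^ a * (if e / s < 3 then (e/s) ^ (-p) else 0)) := by
      rw [if_pos (by rw [div_lt_iff₀ hs0]; linarith)]
      calc _ ≤ e ^ (-p) * (s/4) ^ (-a) := by
            gcongr ?_ * ?_
            · exact mono _ _ _ he hed hp
            · exact mono _ _ _ (by positivity) (by linarith) ha
        _ = _ := by
            rw [Real.div_rpow he.le hs0.le, Real.div_rpow hs0.le (by norm_num), neg_add,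
              Real.rpow_add hs0, Real.rpow_neg (by norm_num : (0:ℝ) ≤ 4)]
            have := Real.rpow_pos_of_pos hs0 (-p)
            field_simp
    refine this.trans (mul_le_mul_of_nonneg_left (by linarith) hS)
  rcases le_or_gt x (2 * s) with h' | h'
  · have : d ^ (-p) * (1 + x) ^ (-a) ≤ s ^ (-(p+a)) * (4 ^ p * (if x / s < 3 then (x/s) ^ (-a) else 0)) := by
      rw [if_pos (by rw [div_lt_iff₀ hs0]; linarith)]
      calc _ ≤ (s/4) ^ (-p) * x ^ (-a) := by
            gcongr ?_ * ?_
            · exact mono _ _ _ (by positivity) h hp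
            · exact mono _ _ _ hx (by linarith) ha
        _ = _ := by
            rw [Real.div_rpow hx.le hs0.le, Real.div_rpow hs0.le (by norm_num), neg_add,
              Real.rpow_add hs0, Real.rpow_neg (by norm_num : (0:ℝ) ≤ 4)]
            have := Real.rpow_pos_of_pos hs0 (-a)
            field_simp
    refine this.trans (mul_le_mul_of_nonneg_left (by linarith) hS)
  · have : d ^ (-p) * (1 + x) ^ (-a) ≤ s ^ (-(p+a)) * (3 ^ (p+a) * (1 + x/s) ^ (-(p+a))) := by
      calc _ ≤ ((s+x)/3) ^ (-p) * ((s+x)/3) ^ (-a) := by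
            gcongr ?_ * ?_
            · exact mono _ _ _ (by positivity) (by linarith) hp
            · exact mono _ _ _ (by positivity) (by linarith) ha
        _ = _ := by
            have : (s+x)/3 = s * (1/3) * (1+x/s) := by field_simp
            rw [← Real.rpow_add (by positivity), ← neg_add, this, Real.mul_rpow (by positivity) (by positivity),
              Real.mul_rpow (by positivity) (by positivity), one_div, Real.inv_rpow (by norm_num), Real.rpow_neg (by norm_num : (0:ℝ) ≤ 3), inv_inv]
            ring
    refine this.trans (mul_le_mul_of_nonneg_left (by linarith) hS)

theorem intb (m : ℕ) (hm : 1 ≤ m) (p : ℝ) (hp : p < m) :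
    Integrable (fun x : EuclideanSpace ℝ (Fin m) => if ‖x‖ < 3 then ‖x‖ ^ (-p) else 0) := by
  have : Nonempty (Fin m) := ⟨⟨0, hm⟩⟩
  rw [integrable_fun_norm_addHaar (volume : Measure (EuclideanSpace ℝ (Fin m)))
    (f := fun r : ℝ => if r < 3 then r ^ (-p) else 0)]
  have h := (intervalIntegral.intervalIntegrable_rpow' (a := 0) (b := 3) (r := (m:ℝ) - 1 - p) (by linarith)).1
  have h2 : IntegrableOn ((Set.Ioc (0:ℝ) 3).indicator fun x : ℝ => x ^ ((m:ℝ) - 1 - p)) (Set.Ioi 0) :=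
    (h.integrable_indicator measurableSet_Ioc).integrableOn
  refine Integrable.mono' h2 ?_ ?_
  · apply Measurable.aestronglyMeasurable
    have h1 : Measurable fun y : ℝ => if y < 3 then y ^ (-p) else 0 :=
      Measurable.ite measurableSet_Iio (by fun_prop) (by fun_prop)
    simp only [smul_eq_mul]
    exact Measurable.mul (by fun_prop) h1
  · filter_upwards [ae_restrict_mem measurableSet_Ioi] with r hr
    have hr : 0 < r := hr
    by_cases h3 : r < 3
    · rw [Set.indicator_of_mem (by exact ⟨hr, h3.le⟩)]
      simp only [h3, if_true, finrank_euclideanSpace_fin, smul_eq_mul]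
      rw [Real.norm_of_nonneg (by positivity), ← Real.rpow_natCast, ← Real.rpow_add hr, Nat.cast_sub hm]
      apply le_of_eq; congr 1; push_cast; ring
    · simp only [h3, if_false, smul_zero, norm_zero]
      exact Set.indicator_nonneg (fun x hx => Real.rpow_nonneg hx.1.le _) _

theorem embSub_left (m k : ℕ) (ξ : EuclideanSpace ℝ (Fin m)) (i : Fin m) :
    embSub m k ξ (Fin.castAdd k i) = ξ i := by
  simp [embSub]

theorem embSub_right (m k : ℕ) (ξ : EuclideanSpace ℝ (Fin m)) (i : Fin k) :
    embSub m k ξ (Fin.natAdd m i) = 0 := by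
  simp [embSub]

theorem norm_embSub (m k : ℕ) (ξ : EuclideanSpace ℝ (Fin m)) : ‖embSub m k ξ‖ = ‖ξ‖ := by
  rw [EuclideanSpace.norm_eq, EuclideanSpace.norm_eq, Fin.sum_univ_add]
  simp [embSub_left, embSub_right]

theorem le_norm_embSub (m k : ℕ) (ξ : EuclideanSpace ℝ (Fin m))
    (y : EuclideanSpace ℝ (Fin (m + k))) :
    ‖ξ - WithLp.toLp 2 (fun i => y (Fin.castAdd k i))‖ ≤ ‖embSub m k ξ - y‖ := by
  rw [EuclideanSpace.norm_eq, EuclideanSpace.norm_eq, Fin.sum_univ_add]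
  apply Real.sqrt_le_sqrt
  simp only [PiLp.sub_apply, embSub_left, embSub_right]
  exact le_add_of_nonneg_right (Finset.sum_nonneg fun i _ => by positivity)

/-- For `0 < β < α < m` there is `C > 0` (depending only on `m, k, α, β`) with
`∫_{ℝ^m} |ξ-y|^{β-m} (1+|ξ|)^{-α} dξ ≤ C (1+|y|)^{β-α}` for every `y ∈ ℝ^{m+k}`. -/
theorem statement5 (m k : ℕ) (hm : 1 ≤ m) (hk : 1 ≤ k) (α β : ℕ)
    (hβ : 0 < β) (hβα : β < α) (hαm : α < m) :
    ∃ C : ℝ, 0 < C ∧ ∀ y : EuclideanSpace ℝ (Fin (m + k)),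
      (∫ ξ : EuclideanSpace ℝ (Fin m),
          ‖embSub m k ξ - y‖ ^ ((β : ℝ) - (m : ℝ)) * (1 + ‖ξ‖) ^ (-(α : ℝ)))
        ≤ C * (1 + ‖y‖) ^ ((β : ℝ) - (α : ℝ)) := by
  have : Nonempty (Fin m) := ⟨⟨0, hm⟩⟩
  have hmα : (α : ℝ) < m := by exact_mod_cast hαm
  have hβα' : (β : ℝ) < α := by exact_mod_cast hβα
  have hβ' : (0 : ℝ) < β := by exact_mod_cast hβ
  obtain ⟨p, hp⟩ : ∃ p : ℝ, p = m - β := ⟨_, rfl⟩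
  obtain ⟨a, ha⟩ : ∃ a : ℝ, a = α := ⟨_, rfl⟩
  set G : EuclideanSpace ℝ (Fin m) → ℝ :=
    fun x => 4 ^ a * (if ‖x‖ < 3 then ‖x‖ ^ (-p) else 0) with hG
  set H : EuclideanSpace ℝ (Fin m) → ℝ :=
    fun x => 4 ^ p * (if ‖x‖ < 3 then ‖x‖ ^ (-a) else 0) + 3 ^ (p + a) * (1 + ‖x‖) ^ (-(p + a))
    with hH
  have iG : Integrable G := (intb m hm p (by linarith)).const_mul _
  have iH : Integrable H := by
    refine ((intb m hm a (by linarith)).const_mul _).add (Integrable.const_mul ?_ _)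
    apply integrable_one_add_norm
    rw [finrank_euclideanSpace_fin]; linarith
  have G0 : 0 ≤ ∫ x, G x := integral_nonneg fun x => by
    simp only [hG, Pi.zero_apply]; split_ifs <;> positivity
  have H0 : 0 ≤ ∫ x, H x := integral_nonneg fun x => by
    simp only [hH, Pi.zero_apply]; split_ifs <;> positivity
  refine ⟨(∫ x, G x) + (∫ x, H x) + 1, by linarith, fun y => ?_⟩
  set z : EuclideanSpace ℝ (Fin m) := WithLp.toLp 2 (fun i => y (Fin.castAdd k i)) with hz
  obtain ⟨s, hs⟩ : ∃ s : ℝ, s = 1 + ‖y‖ := ⟨_, rfl⟩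
  have hs0 : 0 < s := by rw [hs]; positivity
  have iG' : Integrable fun ξ => G (s⁻¹ • (ξ - z)) :=
    (iG.comp_smul (inv_ne_zero hs0.ne')).comp_sub_right z
  have iH' : Integrable fun ξ => H (s⁻¹ • ξ) := iH.comp_smul (inv_ne_zero hs0.ne')
  have key : (∫ ξ : EuclideanSpace ℝ (Fin m),
          ‖embSub m k ξ - y‖ ^ ((β : ℝ) - (m : ℝ)) * (1 + ‖ξ‖) ^ (-(α : ℝ)))
        ≤ ∫ ξ, s ^ (-(p + a)) * (G (s⁻¹ • (ξ - z)) + H (s⁻¹ • ξ)) := by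
    apply integral_mono_of_nonneg
    · exact Filter.Eventually.of_forall fun ξ => by positivity
    · exact (iG'.add iH').const_mul _
    · filter_upwards [compl_mem_ae_iff.2 (measure_singleton (0 : EuclideanSpace ℝ (Fin m))),
        compl_mem_ae_iff.2 (measure_singleton z)] with ξ h0 h1
      have hx : 0 < ‖ξ‖ := norm_pos_iff.2 h0
      have he : 0 < ‖ξ - z‖ := norm_pos_iff.2 (sub_ne_zero.2 h1)
      have := ptw p a s ‖y‖ ‖ξ‖ ‖embSub m k ξ - y‖ ‖ξ - z‖ (by linarith) (by linarith)
        (norm_nonneg _) hs hx he (le_norm_embSub m k ξ y)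
        (by rw [← norm_embSub m k ξ, norm_sub_rev]; exact norm_sub_norm_le _ _)
        (by rw [← norm_embSub m k ξ]; exact norm_sub_norm_le _ _)
      have e1 : (β : ℝ) - m = -p := by linarith
      have n1 : ‖s⁻¹ • (ξ - z)‖ = ‖ξ - z‖ / s := by
        rw [norm_smul, norm_inv, Real.norm_of_nonneg hs0.le]; ring
      have n2 : ‖s⁻¹ • ξ‖ = ‖ξ‖ / s := by
        rw [norm_smul, norm_inv, Real.norm_of_nonneg hs0.le]; ring
      simp only [hG, hH, n1, n2, e1, ← ha]
      rw [← add_assoc]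
      exact this
  refine key.trans ?_
  rw [integral_const_mul, integral_add iG' iH',
    integral_sub_right_eq_self (fun ξ => G (s⁻¹ • ξ)) z,
    Measure.integral_comp_inv_smul_of_nonneg _ _ hs0.le,
    Measure.integral_comp_inv_smul_of_nonneg _ _ hs0.le, finrank_euclideanSpace_fin, ← hs]
  have e2 : s ^ ((β : ℝ) - α) = s ^ (-(p + a)) * s ^ m := by
    rw [← Real.rpow_natCast, ← Real.rpow_add hs0]; congr 1; linarith
  rw [e2, smul_eq_mul, smul_eq_mul]
  have : 0 < s ^ (-(p + a)) * s ^ m := by positivity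
  linarith
end
end

section
/- Let n ≥ 7 and set L₁(y) := (|y|² - 1)/[(1+yₙ)² + |ȳ|²]^{n+1} for y = (ȳ, yₙ) ∈ ℝⁿ₊. Then ∫_{ℝⁿ₊} L₁(y)·|ȳ|⁴·yₙ² dy = ω_{n-2}·((n+1)/n)·12/((n-3)(n-4)(n-5)(n-6))·Iₙⁿ. -/
open MeasureTheory

noncomputable section

/-- The closed upper half-space `ℝⁿ₊ = {y : yₙ ≥ 0}`. -/
def halfSpace (n : ℕ) [NeZero n] : Set (EuclideanSpace ℝ (Fin n)) :=
  {y | 0 ≤ lastCoord n y}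

/-- `I_m^α := ∫₀^∞ s^α/(1+s²)^m ds`; in particular `Iint n n = Iₙⁿ`. -/
def Iint (m α : ℕ) : ℝ := ∫ s in Set.Ioi (0 : ℝ), s ^ α / (1 + s ^ 2) ^ m

/-- `L₁(y) = (|y|²-1)/((1+yₙ)²+|ȳ|²)^{n+1}`. -/
def L1 (n : ℕ) [NeZero n] (y : EuclideanSpace ℝ (Fin n)) : ℝ :=
  (‖y‖ ^ 2 - 1) / ((1 + lastCoord n y) ^ 2 + barNormSq n y) ^ (n + 1)

/-- `L₂(y) = (|y|²-1)/((1+yₙ)²+|ȳ|²)^{n}`. -/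
def L2 (n : ℕ) [NeZero n] (y : EuclideanSpace ℝ (Fin n)) : ℝ :=
  (‖y‖ ^ 2 - 1) / ((1 + lastCoord n y) ^ 2 + barNormSq n y) ^ n

/-- `L₃(y) = (|y|²-1)/((1+yₙ)²+|ȳ|²)^{n-1}`. -/
def L3 (n : ℕ) [NeZero n] (y : EuclideanSpace ℝ (Fin n)) : ℝ :=
  (‖y‖ ^ 2 - 1) / ((1 + lastCoord n y) ^ 2 + barNormSq n y) ^ (n - 1)

open Filter Topology Set

/-- pointwise bound -/
lemma aux_pow_le (a m : ℕ) (h : a ≤ 2 * m) (s : ℝ) (hs : 0 ≤ s) : s ^ a ≤ (1 + s ^ 2) ^ m := by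
  rcases le_total s 1 with h1 | h1
  · calc s ^ a ≤ 1 := pow_le_one₀ hs h1
      _ ≤ _ := one_le_pow₀ (by nlinarith [sq_nonneg s])
  · calc s ^ a ≤ s ^ (2 * m) := pow_le_pow_right₀ h1 h
      _ = (s ^ 2) ^ m := by rw [pow_mul]
      _ ≤ _ := pow_le_pow_left₀ (by positivity) (by linarith) m

lemma aux_int_s10 (a m : ℕ) (h : a + 2 ≤ 2 * m) :
    IntegrableOn (fun s : ℝ => s ^ a / (1 + s ^ 2) ^ m) (Ioi 0) := by
  refine Integrable.mono' (integrable_inv_one_add_sq.integrableOn) ?_ ?_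
  · apply Measurable.aestronglyMeasurable
    fun_prop
  · filter_upwards [ae_restrict_mem measurableSet_Ioi] with s hs
    have hs' : 0 < s := hs
    obtain ⟨k, rfl⟩ : ∃ k, m = k + 1 := ⟨m - 1, by omega⟩
    rw [Real.norm_of_nonneg (by positivity), div_le_iff₀ (by positivity), pow_succ (1 + s ^ 2) k]
    have := aux_pow_le a k (by omega) s hs'.le
    have h0 : (1 + s ^ 2 : ℝ) ≠ 0 := by positivity
    rw [mul_comm, mul_assoc, mul_inv_cancel₀ h0, mul_one]
    exact this

lemma aux_tendsto (a m : ℕ) (h : a + 1 ≤ 2 * m) :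
    Tendsto (fun s : ℝ => s ^ a / (1 + s ^ 2) ^ m) atTop (𝓝 0) := by
  refine squeeze_zero' ?_ ?_ tendsto_inv_atTop_zero
  · filter_upwards [eventually_gt_atTop 0] with s hs
    positivity
  · filter_upwards [eventually_gt_atTop 0] with s hs
    rw [div_le_iff₀ (by positivity)]
    have := aux_pow_le (a + 1) m h s hs.le
    rw [inv_mul_eq_div, le_div_iff₀ hs, ← pow_succ]
    exact this

lemma aux_parts (a m : ℕ) (h : a + 2 ≤ 2 * m) :
    ((a : ℝ) + 1) * Iint m a = 2 * m * Iint (m + 1) (a + 2) := by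
  have key : ∫ s in Ioi (0:ℝ), (((a : ℝ) + 1) * (s ^ a / (1 + s ^ 2) ^ m)
      - 2 * m * (s ^ (a + 2) / (1 + s ^ 2) ^ (m + 1))) = 0 - 0 ^ (a + 1) / (1 + 0 ^ 2) ^ m := by
    refine integral_Ioi_of_hasDerivAt_of_tendsto' (f := fun s : ℝ => s ^ (a + 1) / (1 + s ^ 2) ^ m)
      ?_ ?_ (aux_tendsto (a + 1) m (by omega))
    · intro s _
      have h0 : (1 + s ^ 2 : ℝ) ≠ 0 := by positivity
      obtain ⟨k, rfl⟩ : ∃ k, m = k + 1 := ⟨m - 1, by omega⟩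
      have h1 : HasDerivAt (fun s : ℝ => (1 + s ^ 2)) (2 * s) s := by
        simpa using (hasDerivAt_pow 2 s).const_add 1
      have := (hasDerivAt_pow (a + 1) s).div (h1.pow (k + 1)) (pow_ne_zero _ h0)
      refine this.congr_deriv ?_
      simp only [Nat.add_sub_cancel, Pi.pow_apply]
      push_cast
      field_simp
      ring
    · exact ((aux_int_s10 a m h).const_mul _).sub ((aux_int_s10 (a + 2) (m + 1) (by omega)).const_mul _)
  rw [integral_sub ((aux_int_s10 a m h).const_mul _)
    ((aux_int_s10 (a + 2) (m + 1) (by omega)).const_mul _), integral_const_mul, integral_const_mul] at key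
  simp only [Iint]
  have : (0:ℝ) ^ (a + 1) = 0 := by simp
  rw [this, zero_div, sub_zero] at key
  linarith

lemma aux_split (a m : ℕ) (h : a + 4 ≤ 2 * (m + 1)) :
    Iint m a = Iint (m + 1) a + Iint (m + 1) (a + 2) := by
  simp only [Iint]
  rw [← integral_add (aux_int_s10 a (m + 1) (by omega)) (aux_int_s10 (a + 2) (m + 1) (by omega))]
  refine integral_congr_ae (Eventually.of_forall fun s => ?_)
  have h0 : (1 + s ^ 2 : ℝ) ≠ 0 := by positivity
  simp only
  field_simp
  ring

lemma aux_p (k : ℕ) : IntegrableOn (fun t : ℝ => ((1 + t) ^ (k + 2))⁻¹) (Ioi 0) ∧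
    ∫ t in Ioi (0:ℝ), ((1 + t) ^ (k + 2))⁻¹ = 1 / ((k : ℝ) + 1) := by
  have hd : ∀ x ∈ Ici (0:ℝ), HasDerivAt (fun t : ℝ => -(1 / ((k:ℝ) + 1)) * ((1 + t) ^ (k + 1))⁻¹)
      (((1 + x) ^ (k + 2))⁻¹) x := by
    intro x hx
    have hx' : 0 ≤ x := hx
    have h0 : (1 + x) ≠ 0 := by positivity
    have h1 : HasDerivAt (fun t : ℝ => 1 + t) 1 x := by
      simpa using (hasDerivAt_id x).const_add 1
    have := ((h1.pow (k + 1)).inv (pow_ne_zero _ h0)).const_mul (-(1 / ((k:ℝ) + 1)))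
    refine this.congr_deriv ?_
    simp only [Nat.add_sub_cancel, Pi.pow_apply]
    have : (k:ℝ) + 1 ≠ 0 := by positivity
    push_cast
    field_simp
    ring
  have hl : Tendsto (fun t : ℝ => -(1 / ((k:ℝ) + 1)) * ((1 + t) ^ (k + 1))⁻¹) atTop (𝓝 0) := by
    have : Tendsto (fun t : ℝ => ((1 + t) ^ (k + 1))⁻¹) atTop (𝓝 0) :=
      tendsto_inv_atTop_zero.comp ((tendsto_pow_atTop (by omega)).comp
        (tendsto_atTop_add_const_left _ 1 tendsto_id))
    simpa using this.const_mul (-(1 / ((k:ℝ) + 1)))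
  have hp : ∀ x ∈ Ioi (0:ℝ), 0 ≤ ((1 + x) ^ (k + 2))⁻¹ := by
    intro x hx
    have hx' : 0 < x := hx
    positivity
  have hi := integrableOn_Ioi_deriv_of_nonneg' hd hp hl
  refine ⟨hi, ?_⟩
  rw [integral_Ioi_of_hasDerivAt_of_tendsto' hd hi hl]
  simp

/-- the integrand in terms of `t = yₙ`, `r = |ȳ|` -/
def aux_g (n : ℕ) (t r : ℝ) : ℝ :=
  (t ^ 2 + r ^ 2 - 1) / ((1 + t) ^ 2 + r ^ 2) ^ (n + 1) * (r ^ 2) ^ 2 * t ^ 2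

lemma aux_radial (k : ℕ) (t : ℝ) (ht : 0 ≤ t) :
    ∫ r in Ioi (0:ℝ), r ^ (k + 5) • aux_g (k + 7) t r =
      Iint (k + 8) (k + 11) * (t ^ 2 / (1 + t) ^ (k + 4)) +
        Iint (k + 8) (k + 9) * (t ^ 2 * (t - 1) / (1 + t) ^ (k + 5)) := by
  have hb : 0 < 1 + t := by positivity
  have h := integral_comp_mul_left_Ioi' (fun r => r ^ (k + 5) • aux_g (k + 7) t r) 0 hb
  rw [mul_zero] at h
  rw [← h, smul_eq_mul, ← integral_const_mul]
  simp only [Iint]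
  rw [← integral_mul_const, ← integral_mul_const, ← integral_add
    ((aux_int_s10 (k + 11) (k + 8) (by omega)).mul_const _)
    ((aux_int_s10 (k + 9) (k + 8) (by omega)).mul_const _)]
  refine integral_congr_ae (Eventually.of_forall fun s => ?_)
  have h0 : (1 + s ^ 2 : ℝ) ≠ 0 := by positivity
  have h1 : (1 + t) ^ 2 + ((1 + t) * s) ^ 2 = (1 + t) ^ 2 * (1 + s ^ 2) := by ring
  simp only [aux_g, smul_eq_mul]
  rw [h1, mul_pow (_ ^ 2) _ (k + 7 + 1), ← pow_mul]
  generalize hQ : (1 + s ^ 2) ^ (k + 7 + 1) = Q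
  have hQ0 : Q ≠ 0 := by rw [← hQ]; positivity
  have e1 : (1 + t) ^ (2 * (k + 7 + 1)) = ((1 + t) ^ k) ^ 2 * (1 + t) ^ 16 := by ring
  have e2 : (1 + t) ^ (k + 4) = (1 + t) ^ k * (1 + t) ^ 4 := by ring
  have e3 : (1 + t) ^ (k + 5) = (1 + t) ^ k * (1 + t) ^ 5 := by ring
  have e4 : ((1 + t) * s) ^ (k + 5) = (1 + t) ^ k * (1 + t) ^ 5 * s ^ k * s ^ 5 := by
    rw [mul_pow]; ring
  have hU : (1 + t) ^ k ≠ 0 := by positivity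
  rw [e1, e2, e3, e4, show s ^ (k + 11) = s ^ k * s ^ 11 by ring,
    show s ^ (k + 9) = s ^ k * s ^ 9 by ring]
  generalize (1 + t) ^ k = U at *
  generalize s ^ k = V
  have : 1 + t ≠ 0 := hb.ne'
  obtain ⟨u, rfl⟩ : ∃ u, t = u - 1 := ⟨t + 1, by ring⟩
  simp only [add_sub_cancel] at *
  field_simp
  ring

lemma aux_final (k : ℕ) :
    ∫ t in Ici (0:ℝ), (∫ r in Ioi (0:ℝ), r ^ (k + 5) • aux_g (k + 7) t r) =
      (((k : ℝ) + 8) / ((k : ℝ) + 7)) *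
        (12 / (((k : ℝ) + 4) * ((k : ℝ) + 3) * ((k : ℝ) + 2) * ((k : ℝ) + 1))) *
        Iint (k + 7) (k + 7) := by
  rw [integral_Ici_eq_integral_Ioi]
  set A := Iint (k + 8) (k + 11) with hA
  set B := Iint (k + 8) (k + 9) with hB
  obtain ⟨i0, v0⟩ := aux_p k
  obtain ⟨i1, v1⟩ := aux_p (k + 1)
  obtain ⟨i2, v2⟩ := aux_p (k + 2)
  obtain ⟨i3, v3⟩ := aux_p (k + 3)
  have e : ∫ t in Ioi (0:ℝ), (∫ r in Ioi (0:ℝ), r ^ (k + 5) • aux_g (k + 7) t r) =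
      ∫ t in Ioi (0:ℝ), ((A + B) * ((1 + t) ^ (k + 2))⁻¹ + (-2 * A - 4 * B) * ((1 + t) ^ (k + 1 + 2))⁻¹
        + (A + 5 * B) * ((1 + t) ^ (k + 2 + 2))⁻¹ + (-2 * B) * ((1 + t) ^ (k + 3 + 2))⁻¹) := by
    refine setIntegral_congr_fun measurableSet_Ioi fun t ht => ?_
    have ht' : 0 < t := ht
    rw [aux_radial k t ht'.le, ← hA, ← hB]
    obtain ⟨u, rfl⟩ : ∃ u, t = u - 1 := ⟨t + 1, by ring⟩
    have hu : u ≠ 0 := by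
      have : 0 < u := by linarith
      exact this.ne'
    simp only [add_sub_cancel]
    field_simp
    ring
  rw [e, integral_add (by exact ((i0.const_mul _).add (i1.const_mul _)).add (i2.const_mul _))
    (i3.const_mul _), integral_add (by exact (i0.const_mul _).add (i1.const_mul _))
    (i2.const_mul _),
    integral_add (i0.const_mul _) (i1.const_mul _)]
  simp only [integral_const_mul]
  rw [v0, v1, v2, v3]
  have r1 := aux_parts (k + 7) (k + 7) (by omega)
  have r2 := aux_parts (k + 9) (k + 7) (by omega)
  have r3 := aux_split (k + 9) (k + 7) (by omega)
  simp only [add_assoc, Nat.reduceAdd] at r1 r2 r3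
  rw [← hB] at r1 r3
  rw [← hA] at r2 r3
  rw [r3] at r2
  push_cast at r1 r2 ⊢
  have hI : Iint (k + 7) (k + 7) = 2 * (k + 7) / (k + 8) * B := by
    have : (k:ℝ) + 8 ≠ 0 := by positivity
    field_simp
    linear_combination r1
  have hA' : A = (k + 10) / (k + 4) * B := by
    have : (k:ℝ) + 4 ≠ 0 := by positivity
    field_simp
    linear_combination -r2
  rw [hI, hA']
  have h1 : (k:ℝ) + 1 ≠ 0 := by positivity
  have h2 : (k:ℝ) + 2 ≠ 0 := by positivity
  have h3 : (k:ℝ) + 3 ≠ 0 := by positivity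
  have h4 : (k:ℝ) + 4 ≠ 0 := by positivity
  have h7 : (k:ℝ) + 7 ≠ 0 := by positivity
  have h8 : (k:ℝ) + 8 ≠ 0 := by positivity
  have h11 : (k:ℝ) + 1 + 1 ≠ 0 := by positivity
  have h21 : (k:ℝ) + 2 + 1 ≠ 0 := by positivity
  have h31 : (k:ℝ) + 3 + 1 ≠ 0 := by positivity
  field_simp
  ring

/-- splitting off the last coordinate -/
def aux_e (d : ℕ) : EuclideanSpace ℝ (Fin (d + 1)) ≃ᵐ ℝ × EuclideanSpace ℝ (Fin d) :=
  ((MeasurableEquiv.toLp 2 (Fin (d + 1) → ℝ)).symm.trans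
    (MeasurableEquiv.piFinSuccAbove (fun _ => ℝ) (Fin.last d))).trans
    ((MeasurableEquiv.refl ℝ).prodCongr (MeasurableEquiv.toLp 2 (Fin d → ℝ)))

lemma aux_e_mp (d : ℕ) : MeasurePreserving (aux_e d) := by
  refine ((EuclideanSpace.volume_preserving_symm_measurableEquiv_toLp (Fin (d + 1))).trans
    (volume_preserving_piFinSuccAbove (fun _ => ℝ) (Fin.last d))).trans ?_
  exact (MeasurePreserving.id _).prod (PiLp.volume_preserving_toLp (Fin d))

lemma aux_e_fst (d : ℕ) (y : EuclideanSpace ℝ (Fin (d + 1))) :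
    (aux_e d y).1 = lastCoord (d + 1) y := rfl

lemma aux_e_snd (d : ℕ) (y : EuclideanSpace ℝ (Fin (d + 1))) :
    ‖(aux_e d y).2‖ ^ 2 = barNormSq (d + 1) y := by
  have : ∀ i, (aux_e d y).2 i = y (Fin.castSucc i) := by
    intro i
    rw [← Fin.succAbove_last]
    rfl
  rw [EuclideanSpace.real_norm_sq_eq, barNormSq, Fin.sum_univ_castSucc]
  simp [this]

lemma aux_norm (d : ℕ) (y : EuclideanSpace ℝ (Fin (d + 1))) :
    ‖y‖ ^ 2 = lastCoord (d + 1) y ^ 2 + barNormSq (d + 1) y := by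
  rw [EuclideanSpace.real_norm_sq_eq, barNormSq, Fin.sum_univ_castSucc, Fin.sum_univ_castSucc]
  have : lastCoord (d + 1) y = y (Fin.last d) := rfl
  simp [this, add_comm]

lemma aux_bound (k : ℕ) (t R : ℝ) (ht : 0 ≤ t) (hR : 0 ≤ R) :
    |(t ^ 2 + R - 1) / ((1 + t) ^ 2 + R) ^ (k + 7 + 1) * R ^ 2 * t ^ 2| ≤
      ((1 + (t ^ 2 + R)) ^ (k + 4))⁻¹ := by
  set Q := (1 + t) ^ 2 + R with hQ
  have hq : 1 + (t ^ 2 + R) ≤ Q := by rw [hQ]; nlinarith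
  have hp : 0 < 1 + (t ^ 2 + R) := by positivity
  have hQ0 : 0 < Q := by linarith
  have h1 : |t ^ 2 + R - 1| ≤ Q := by
    rw [abs_le]; constructor <;> nlinarith [sq_nonneg t]
  have h2 : R ^ 2 ≤ Q ^ 2 := pow_le_pow_left₀ hR (by nlinarith [sq_nonneg t]) 2
  have h3 : t ^ 2 ≤ Q := by nlinarith
  have : |(t ^ 2 + R - 1) / Q ^ (k + 7 + 1) * R ^ 2 * t ^ 2| =
      (|t ^ 2 + R - 1| * R ^ 2 * t ^ 2) / Q ^ (k + 7 + 1) := by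
    rw [abs_mul, abs_mul, abs_div, abs_of_pos (pow_pos hQ0 _), abs_of_nonneg (sq_nonneg R),
      abs_of_nonneg (sq_nonneg t)]
    ring
  rw [this]
  calc _ ≤ (Q * Q ^ 2 * Q) / Q ^ (k + 7 + 1) := by gcongr
    _ = (Q ^ (k + 4))⁻¹ := by
      have := hQ0.ne'
      field_simp
      ring
    _ ≤ _ := by gcongr

lemma aux_integrable (k : ℕ) :
    Integrable ((Ici (0:ℝ) ×ˢ (univ : Set (EuclideanSpace ℝ (Fin (k + 6))))).indicator
      (fun p : ℝ × EuclideanSpace ℝ (Fin (k + 6)) => aux_g (k + 7) p.1 ‖p.2‖)) := by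
  rw [← (aux_e_mp (k + 6)).integrable_comp_emb (aux_e (k + 6)).measurableEmbedding]
  have hb := integrable_rpow_neg_one_add_norm_sq (E := EuclideanSpace ℝ (Fin (k + 6 + 1)))
    (μ := volume) (r := 2 * ((k + 4 : ℕ) : ℝ)) (by simp; linarith)
  refine hb.mono' ?_ (Eventually.of_forall fun y => ?_)
  · apply Measurable.aestronglyMeasurable
    refine Measurable.comp ?_ (aux_e (k + 6)).measurable
    refine Measurable.indicator ?_ (measurableSet_Ici.prod MeasurableSet.univ)
    unfold aux_g
    fun_prop
  · have e1 : (1 + ‖y‖ ^ 2) ^ (-(2 * ((k + 4 : ℕ) : ℝ)) / 2) = ((1 + ‖y‖ ^ 2) ^ (k + 4))⁻¹ := by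
      rw [show -(2 * ((k + 4 : ℕ) : ℝ)) / 2 = -((k + 4 : ℕ) : ℝ) by ring,
        Real.rpow_neg (by positivity), Real.rpow_natCast]
    rw [e1, Function.comp_apply, indicator_apply]
    split_ifs with h
    · have ht : 0 ≤ (aux_e (k + 6) y).1 := h.1
      rw [aux_norm, ← aux_e_fst, ← aux_e_snd]
      exact aux_bound k _ _ ht (by positivity)
    · simp only [norm_zero]; positivity

lemma aux_main (k : ℕ) :
    ∫ y in halfSpace (k + 6 + 1), L1 (k + 6 + 1) y * (barNormSq (k + 6 + 1) y) ^ 2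
        * (lastCoord (k + 6 + 1) y) ^ 2
      = sphereArea (k + 6) *
        ∫ t in Ici (0:ℝ), (∫ r in Ioi (0:ℝ), r ^ (k + 5) • aux_g (k + 7) t r) := by
  have hm : MeasurableSet (halfSpace (k + 6 + 1)) := by
    have : halfSpace (k + 6 + 1) = (fun y => (aux_e (k + 6) y).1) ⁻¹' Ici 0 := rfl
    rw [this]
    exact (measurable_fst.comp (aux_e (k + 6)).measurable) measurableSet_Ici
  rw [← integral_indicator hm]
  have h1 : (halfSpace (k + 6 + 1)).indicator (fun y => L1 (k + 6 + 1) y *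
      (barNormSq (k + 6 + 1) y) ^ 2 * (lastCoord (k + 6 + 1) y) ^ 2) = fun y =>
      ((Ici (0:ℝ) ×ˢ (univ : Set (EuclideanSpace ℝ (Fin (k + 6))))).indicator
      (fun p : ℝ × EuclideanSpace ℝ (Fin (k + 6)) => aux_g (k + 7) p.1 ‖p.2‖)) (aux_e (k + 6) y) := by
    funext y
    have hmem : y ∈ halfSpace (k + 6 + 1) ↔
        aux_e (k + 6) y ∈ Ici (0:ℝ) ×ˢ (univ : Set (EuclideanSpace ℝ (Fin (k + 6)))) := by
      simp [halfSpace, aux_e_fst]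
    by_cases hy : y ∈ halfSpace (k + 6 + 1)
    · rw [indicator_of_mem hy, indicator_of_mem (hmem.1 hy), aux_g, aux_e_snd, aux_e_fst, L1,
        aux_norm]
    · rw [indicator_of_notMem hy, indicator_of_notMem (fun h => hy (hmem.2 h))]
  rw [h1, (aux_e_mp (k + 6)).integral_comp (aux_e (k + 6)).measurableEmbedding]
  have hint := aux_integrable k
  rw [Measure.volume_eq_prod] at hint ⊢
  rw [integral_prod _ hint, ← integral_const_mul, ← integral_indicator measurableSet_Ici]
  refine integral_congr_ae (Eventually.of_forall fun t => ?_)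
  simp only [indicator_apply]
  by_cases ht : t ∈ Ici (0:ℝ)
  · simp only [mem_prod, ht, mem_univ, and_self, if_true]
    rw [integral_fun_norm_addHaar volume (fun r => aux_g (k + 7) t r)]
    simp [sphereArea, Measure.real, mul_assoc]
  · simp [ht]

/-- `∫_{ℝⁿ₊} L₁ |ȳ|⁴ yₙ² dy = ω_{n-2} ((n+1)/n) · 12/((n-3)(n-4)(n-5)(n-6)) · Iₙⁿ`. -/
theorem statement10 (n : ℕ) [NeZero n] (hn : 7 ≤ n) :
    ∫ y in halfSpace n, L1 n y * (barNormSq n y) ^ 2 * (lastCoord n y) ^ 2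
      = sphereArea (n - 1) * (((n : ℝ) + 1) / (n : ℝ))
          * (12 / (((n : ℝ) - 3) * ((n : ℝ) - 4) * ((n : ℝ) - 5) * ((n : ℝ) - 6)))
          * Iint n n := by
  obtain ⟨k, rfl⟩ : ∃ k, n = k + 6 + 1 := ⟨n - 7, by omega⟩
  have h := aux_main k
  rw [aux_final] at h
  refine h.trans ?_
  rw [Nat.add_sub_cancel]
  push_cast
  rw [show (k:ℝ) + 6 + 1 + 1 = k + 8 by ring, show (k:ℝ) + 6 + 1 = k + 7 by ring,
    show (k:ℝ) + 7 - 3 = k + 4 by ring, show (k:ℝ) + 7 - 4 = k + 3 by ring,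
    show (k:ℝ) + 7 - 5 = k + 2 by ring, show (k:ℝ) + 7 - 6 = k + 1 by ring]
  ring
end
end

section
/- Let n ≥ 7 and set L₁(y) := (|y|² - 1)/[(1+yₙ)² + |ȳ|²]^{n+1} for y = (ȳ, yₙ) ∈ ℝⁿ₊. Then ∫_{ℝⁿ₊} L₁(y)·|ȳ|²·yₙ⁴ dy = ω_{n-2}·144/(n(n-2)(n-3)(n-4)(n-5)(n-6))·Iₙⁿ. -/
open MeasureTheory

noncomputable section

open Set Filter Topology in
lemma aux_intOn_I (p k : ℕ) (h : p + 2 ≤ 2 * k) :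
    IntegrableOn (fun s : ℝ => s ^ p / (1 + s ^ 2) ^ k) (Ioi 0) := by
  have hc : Continuous (fun s : ℝ => s ^ p / (1 + s ^ 2) ^ k) := by
    apply Continuous.div (by fun_prop) (by fun_prop)
    intro s; positivity
  refine Integrable.mono' (integrable_inv_one_add_sq.integrableOn) hc.aestronglyMeasurable ?_
  filter_upwards [ae_restrict_mem measurableSet_Ioi] with s hs
  have hs0 : (0 : ℝ) < s := hs
  obtain ⟨j, rfl⟩ : ∃ j, k = j + 1 := ⟨k - 1, by omega⟩
  rw [Real.norm_of_nonneg (by positivity), inv_eq_one_div, div_le_div_iff₀ (by positivity) (by positivity),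
    one_mul, pow_succ]
  refine mul_le_mul_of_nonneg_right ?_ (by positivity)
  by_cases h1 : s ≤ 1
  · exact (pow_le_one₀ hs0.le h1).trans (one_le_pow₀ (by nlinarith))
  · push Not at h1
    calc s ^ p ≤ s ^ (2 * j) := pow_le_pow_right₀ h1.le (by omega)
      _ = (s ^ 2) ^ j := pow_mul ..
      _ ≤ (1 + s ^ 2) ^ j := pow_le_pow_left₀ (by positivity) (by linarith) j

open Set Filter Topology in
lemma aux_intOn_J (p k : ℕ) (h : p + 2 ≤ k) :
    IntegrableOn (fun s : ℝ => s ^ p / (1 + s) ^ k) (Ioi 0) := by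
  have hc : ContinuousOn (fun s : ℝ => s ^ p / (1 + s) ^ k) (Ioi 0) := by
    apply ContinuousOn.div (by fun_prop) (by fun_prop)
    intro s hs; have : (0:ℝ) < s := hs; positivity
  refine Integrable.mono' (integrable_inv_one_add_sq.integrableOn)
    (hc.aestronglyMeasurable measurableSet_Ioi) ?_
  filter_upwards [ae_restrict_mem measurableSet_Ioi] with s hs
  have hs0 : (0 : ℝ) < s := hs
  obtain ⟨j, rfl⟩ : ∃ j, k = j + 2 := ⟨k - 2, by omega⟩
  rw [Real.norm_of_nonneg (by positivity), inv_eq_one_div, div_le_div_iff₀ (by positivity) (by positivity),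
    one_mul, pow_add]
  have h1 : s ^ p ≤ (1 + s) ^ j :=
    (pow_le_pow_left₀ hs0.le (by linarith) p).trans (pow_le_pow_right₀ (by linarith) (by omega))
  gcongr
  nlinarith

open Set Filter Topology in
lemma aux_tendsto_J (p k : ℕ) (h : p + 1 ≤ k) :
    Tendsto (fun s : ℝ => s ^ p / (1 + s) ^ k) atTop (𝓝 0) := by
  refine squeeze_zero' (g := fun s : ℝ => s⁻¹) ?_ ?_ tendsto_inv_atTop_zero
  · filter_upwards [eventually_gt_atTop (0:ℝ)] with s hs
    positivity
  · filter_upwards [eventually_gt_atTop (0:ℝ)] with s hs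
    rw [inv_eq_one_div, div_le_div_iff₀ (by positivity) (by positivity), one_mul, ← pow_succ]
    exact (pow_le_pow_left₀ hs.le (by linarith) _).trans (pow_le_pow_right₀ (by linarith) h)

open Set Filter Topology in
lemma aux_tendsto_I (p k : ℕ) (h : p + 1 ≤ 2 * k) :
    Tendsto (fun s : ℝ => s ^ p / (1 + s ^ 2) ^ k) atTop (𝓝 0) := by
  refine squeeze_zero' (g := fun s : ℝ => s⁻¹) ?_ ?_ tendsto_inv_atTop_zero
  · filter_upwards [eventually_gt_atTop (0:ℝ)] with s hs
    positivity
  · filter_upwards [eventually_gt_atTop (1:ℝ)] with s hs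
    rw [inv_eq_one_div, div_le_div_iff₀ (by positivity) (by positivity), one_mul, ← pow_succ]
    calc s ^ (p+1) ≤ s ^ (2 * k) := pow_le_pow_right₀ hs.le (by omega)
      _ = (s ^ 2) ^ k := pow_mul ..
      _ ≤ _ := by gcongr; linarith

/-- The beta-type integrals in the normal variable. -/
def Jaux (p k : ℕ) : ℝ := ∫ t in Set.Ioi (0 : ℝ), t ^ p / (1 + t) ^ k

open Set Filter Topology in
lemma Jaux_zero (k : ℕ) : Jaux 0 (k + 2) = 1 / ((k : ℝ) + 1) := by
  have hd : ∀ x ∈ Ici (0:ℝ), HasDerivAt (fun s : ℝ => -(1 / ((k:ℝ)+1)) * (s ^ 0 / (1 + s) ^ (k+1)))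
      (x ^ 0 / (1 + x) ^ (k + 2)) x := by
    intro x hx
    have hx0 : (0:ℝ) ≤ x := hx
    have h1 : HasDerivAt (fun s : ℝ => (1 + s) ^ (k+1)) (((k+1 : ℕ):ℝ) * (1 + x) ^ k * 1) x := by
      exact ((hasDerivAt_id x).const_add 1).pow (k+1)
    have h2 := (((hasDerivAt_const x (1:ℝ)).div h1 (by positivity))).const_mul (-(1 / ((k:ℝ)+1)))
    simp only [pow_zero]
    refine HasDerivAt.congr_deriv h2 ?_
    push_cast
    field_simp
    ring
  have := integral_Ioi_of_hasDerivAt_of_tendsto' hd (aux_intOn_J 0 (k+2) (by omega))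
    ((aux_tendsto_J 0 (k+1) (by omega)).const_mul _)
  rw [Jaux, this]; simp

open Set Filter Topology in
lemma Jaux_succ (p k : ℕ) (h : p + 2 ≤ k) :
    Jaux (p + 1) (k + 1) = ((p:ℝ) + 1) / k * Jaux p k := by
  obtain ⟨k, rfl⟩ : ∃ j, k = j + 1 := ⟨k - 1, by omega⟩
  have hd : ∀ x ∈ Ici (0:ℝ), HasDerivAt (fun s : ℝ => s ^ (p+1) / (1 + s) ^ (k+1))
      (((p:ℝ)+1) * (x ^ p / (1 + x) ^ (k + 1)) - ((k:ℝ) + 1) * (x ^ (p+1) / (1+x) ^ (k+1+1))) x := by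
    intro x hx
    have hx0 : (0:ℝ) ≤ x := hx
    have h1 : HasDerivAt (fun s : ℝ => (1 + s) ^ (k+1)) (((k+1 : ℕ):ℝ) * (1 + x) ^ k * 1) x := by
      exact ((hasDerivAt_id x).const_add 1).pow (k+1)
    have h2 := (hasDerivAt_pow (p+1) x).div h1 (by positivity)
    refine HasDerivAt.congr_deriv h2 ?_
    push_cast
    field_simp
    ring
  have i1 := (aux_intOn_J p (k+1) (by omega)).const_mul ((p:ℝ)+1)
  have i2 := (aux_intOn_J (p+1) (k+1+1) (by omega)).const_mul ((k:ℝ)+1)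
  have := integral_Ioi_of_hasDerivAt_of_tendsto' hd (i1.sub i2)
    (aux_tendsto_J (p+1) (k+1) (by omega))
  rw [integral_sub i1 i2, integral_const_mul, integral_const_mul] at this
  simp only [Jaux]
  push_cast
  have hk : (k:ℝ) + 1 ≠ 0 := by positivity
  field_simp
  simp at this
  linarith

open Set Filter Topology in
lemma Iint_add (p k : ℕ) (h : p + 4 ≤ 2 * (k+1)) :
    Iint (k+1) p + Iint (k+1) (p+2) = Iint k p := by
  simp only [Iint]
  rw [← integral_add (aux_intOn_I _ _ (by omega)) (aux_intOn_I _ _ (by omega))]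
  congr 1; ext s
  have : (1 + s^2) ≠ 0 := by positivity
  field_simp
  ring

open Set Filter Topology in
lemma Iint_rec (n : ℕ) (hn : 2 ≤ n) :
    2 * (n:ℝ) * Iint (n+1) (n+2) = ((n:ℝ) + 1) * Iint n n := by
  have hd : ∀ x ∈ Ici (0:ℝ), HasDerivAt (fun s : ℝ => s ^ (n+1) / (1 + s^2) ^ n)
      (((n:ℝ)+1) * (x ^ n / (1 + x^2) ^ n) - (2 * (n:ℝ)) * (x ^ (n+2) / (1+x^2) ^ (n+1))) x := by
    intro x hx
    obtain ⟨k, rfl⟩ : ∃ j, n = j + 1 := ⟨n - 1, by omega⟩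
    have h1 : HasDerivAt (fun s : ℝ => (1 + s^2) ^ (k+1)) (((k+1 : ℕ):ℝ) * (1 + x^2) ^ k * (2 * x)) x := by
      simpa using! ((hasDerivAt_pow 2 x).const_add 1).pow (k+1)
    have h2 := (hasDerivAt_pow (k+1+1) x).div h1 (by positivity)
    refine HasDerivAt.congr_deriv h2 ?_
    push_cast
    have : (1 + x^2) ≠ 0 := by positivity
    field_simp
    ring
  have i1 := (aux_intOn_I n n (by omega)).const_mul ((n:ℝ)+1)
  have i2 := (aux_intOn_I (n+2) (n+1) (by omega)).const_mul (2 * (n:ℝ))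
  have := integral_Ioi_of_hasDerivAt_of_tendsto' hd (i1.sub i2)
    (aux_tendsto_I (n+1) n (by omega))
  rw [integral_sub i1 i2, integral_const_mul, integral_const_mul] at this
  simp only [Iint]
  simp at this
  linarith

open Set in
lemma scaled_intOn (p k : ℕ) (h : p + 2 ≤ 2 * k) (a : ℝ) (ha : 0 < a) :
    IntegrableOn (fun r : ℝ => r ^ p / (a ^ 2 + r ^ 2) ^ k) (Ioi 0) := by
  have h0 := integrableOn_Ioi_comp_mul_left_iff (fun r : ℝ => r ^ p / (a ^ 2 + r ^ 2) ^ k) 0 ha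
  rw [mul_zero] at h0
  rw [← h0]
  refine IntegrableOn.congr_fun ((aux_intOn_I p k h).const_mul (a ^ p / a ^ (2 * k))) (fun s _ => ?_)
    measurableSet_Ioi
  have : a ^ 2 + (a * s) ^ 2 = a ^ 2 * (1 + s ^ 2) := by ring
  rw [this, mul_pow, mul_pow, ← pow_mul]
  have : (1 + s^2) ≠ 0 := by positivity
  field_simp

open Set in
lemma scaled_int (p k : ℕ) (a : ℝ) (ha : 0 < a) :
    ∫ r in Ioi (0:ℝ), r ^ p / (a ^ 2 + r ^ 2) ^ k = a ^ (p + 1) / a ^ (2 * k) * Iint k p := by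
  have h0 := integral_comp_mul_left_Ioi' (fun r : ℝ => r ^ p / (a ^ 2 + r ^ 2) ^ k) 0 ha
  rw [mul_zero] at h0
  rw [← h0, Iint, ← integral_const_mul, smul_eq_mul, ← integral_const_mul]
  congr 1
  ext s
  have : a ^ 2 + (a * s) ^ 2 = a ^ 2 * (1 + s ^ 2) := by ring
  rw [this, mul_pow, mul_pow, ← pow_mul]
  have : (1 + s^2) ≠ 0 := by positivity
  field_simp
  ring

/-- The splitting `ℝ × ℝᵐ ≃ ℝ^{m+1}`, the first factor going to the last coordinate. -/
def splitEquiv (m : ℕ) : (ℝ × EuclideanSpace ℝ (Fin m)) ≃ᵐ EuclideanSpace ℝ (Fin (m + 1)) :=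
  ((MeasurableEquiv.refl ℝ).prodCongr (MeasurableEquiv.toLp 2 (Fin m → ℝ)).symm).trans
    ((MeasurableEquiv.piFinSuccAbove (fun _ : Fin (m + 1) => ℝ) (Fin.last m)).symm.trans
      (MeasurableEquiv.toLp 2 (Fin (m + 1) → ℝ)))

lemma splitEquiv_mp (m : ℕ) : MeasurePreserving (splitEquiv m) := by
  have h1 : MeasurePreserving
      ((MeasurableEquiv.refl ℝ).prodCongr (MeasurableEquiv.toLp 2 (Fin m → ℝ)).symm) :=
    (MeasurePreserving.id (volume : Measure ℝ)).prod
      (EuclideanSpace.volume_preserving_symm_measurableEquiv_toLp (Fin m))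
  have h2 := (volume_preserving_piFinSuccAbove (fun _ : Fin (m + 1) => ℝ) (Fin.last m)).symm
  have h3 := (EuclideanSpace.volume_preserving_symm_measurableEquiv_toLp (Fin (m + 1))).symm
  exact (h3.comp h2).comp h1

lemma splitEquiv_last (m : ℕ) (p : ℝ × EuclideanSpace ℝ (Fin m)) :
    splitEquiv m p (Fin.last m) = p.1 := by
  change (Fin.insertNth (α := fun _ => ℝ) (Fin.last m) p.1 p.2.ofLp : Fin (m+1) → ℝ) (Fin.last m) = p.1
  simp

lemma splitEquiv_castSucc (m : ℕ) (p : ℝ × EuclideanSpace ℝ (Fin m)) (i : Fin m) :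
    splitEquiv m p i.castSucc = p.2 i := by
  change (Fin.insertNth (α := fun _ => ℝ) (Fin.last m) p.1 p.2.ofLp : Fin (m+1) → ℝ) i.castSucc = p.2 i
  rw [← Fin.succAbove_last_apply, Fin.insertNth_apply_succAbove]

lemma splitEquiv_lastCoord (m : ℕ) [NeZero (m+1)] (p : ℝ × EuclideanSpace ℝ (Fin m)) :
    lastCoord (m+1) (splitEquiv m p) = p.1 := splitEquiv_last m p

lemma splitEquiv_bar (m : ℕ) [NeZero (m+1)] (p : ℝ × EuclideanSpace ℝ (Fin m)) :
    barNormSq (m+1) (splitEquiv m p) = ‖p.2‖ ^ 2 := by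
  rw [barNormSq, Fin.sum_univ_castSucc, EuclideanSpace.norm_sq_eq]
  simp [splitEquiv_castSucc]

lemma splitEquiv_norm (m : ℕ) (p : ℝ × EuclideanSpace ℝ (Fin m)) :
    ‖splitEquiv m p‖ ^ 2 = ‖p.2‖ ^ 2 + p.1 ^ 2 := by
  rw [EuclideanSpace.norm_sq_eq, EuclideanSpace.norm_sq_eq, Fin.sum_univ_castSucc]
  simp [splitEquiv_castSucc, splitEquiv_last]

lemma split_integral (m : ℕ) [NeZero (m+1)] :
    ∫ y in halfSpace (m+1), L1 (m+1) y * barNormSq (m+1) y * (lastCoord (m+1) y) ^ 4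
    = ∫ p in (Set.Ici (0:ℝ)) ×ˢ (Set.univ : Set (EuclideanSpace ℝ (Fin m))),
      (‖p.2‖ ^ 2 + p.1 ^ 2 - 1) / ((1 + p.1) ^ 2 + ‖p.2‖ ^ 2) ^ (m + 2) * ‖p.2‖ ^ 2 * p.1 ^ 4
      ∂((volume : Measure ℝ).prod volume) := by
  rw [← (splitEquiv_mp m).setIntegral_preimage_emb (splitEquiv m).measurableEmbedding]
  have : (splitEquiv m) ⁻¹' halfSpace (m+1) = (Set.Ici (0:ℝ)) ×ˢ Set.univ := by
    ext p
    simp [halfSpace, splitEquiv_lastCoord]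
  rw [this]
  simp only [L1, splitEquiv_lastCoord, splitEquiv_bar, splitEquiv_norm]
  rfl

lemma radial_int (m : ℕ) (hm : 1 ≤ m) (f : ℝ → ℝ) :
    ∫ z : EuclideanSpace ℝ (Fin m), f ‖z‖ = sphereArea m * ∫ r in Set.Ioi (0:ℝ), r ^ (m - 1) * f r := by
  have : Nonempty (Fin m) := ⟨⟨0, hm⟩⟩
  rw [integral_fun_norm_addHaar]
  simp [sphereArea, Measure.real, mul_assoc]

lemma radial_intble (m : ℕ) (hm : 1 ≤ m) (f : ℝ → ℝ) 
    (h : IntegrableOn (fun r => r ^ (m - 1) * f r) (Set.Ioi (0:ℝ))) :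
    Integrable (fun z : EuclideanSpace ℝ (Fin m) => f ‖z‖) := by
  have : Nonempty (Fin m) := ⟨⟨0, hm⟩⟩
  rw [integrable_fun_norm_addHaar]
  simpa using h

lemma dom_intble (m : ℕ) (hm : 6 ≤ m) :
    IntegrableOn (fun p : ℝ × EuclideanSpace ℝ (Fin m) =>
      1 / ((1 + p.1) ^ 2 + ‖p.2‖ ^ 2) ^ (m + 1) * ‖p.2‖ ^ 2 * p.1 ^ 4)
      ((Set.Ici (0:ℝ)) ×ˢ Set.univ) ((volume : Measure ℝ).prod volume) := by
  rw [IntegrableOn, ← Measure.prod_restrict, Measure.restrict_univ, integrable_prod_iff]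
  · have key : ∀ t : ℝ, 0 ≤ t → (∀ r : ℝ, r ^ (m-1) * (1 / ((1 + t) ^ 2 + r ^ 2) ^ (m + 1) * r ^ 2 * t ^ 4)
      = t ^ 4 * (r ^ (m+1) / ((1 + t) ^ 2 + r ^ 2) ^ (m + 1))) := by
      intro t ht r
      obtain ⟨k, rfl⟩ : ∃ j, m = j + 1 := ⟨m - 1, by omega⟩
      simp only [add_tsub_cancel_right]
      ring
    constructor
    · filter_upwards [ae_restrict_mem measurableSet_Ici] with t ht
      have ht0 : (0:ℝ) ≤ t := ht
      apply radial_intble m (by omega) (fun r => 1 / ((1 + t) ^ 2 + r ^ 2) ^ (m + 1) * r ^ 2 * t ^ 4)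
      simp_rw [key t ht0]
      exact (scaled_intOn (m+1) (m+1) (by omega) (1+t) (by positivity)).const_mul _
    · change IntegrableOn _ _ _
      rw [integrableOn_Ici_iff_integrableOn_Ioi]
      refine IntegrableOn.congr_fun
        ((aux_intOn_J 4 m (by omega)).const_mul (sphereArea m * Iint (m+1) (m+1))) (fun t ht => ?_)
        measurableSet_Ioi
      have ht0 : (0:ℝ) < t := ht
      have h1 : ∀ z : EuclideanSpace ℝ (Fin m),
        ‖1 / ((1 + t) ^ 2 + ‖z‖ ^ 2) ^ (m + 1) * ‖z‖ ^ 2 * t ^ 4‖ =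
        1 / ((1 + t) ^ 2 + ‖z‖ ^ 2) ^ (m + 1) * ‖z‖ ^ 2 * t ^ 4 := by
        intro z
        rw [Real.norm_of_nonneg (by positivity)]
      simp_rw [h1]
      rw [radial_int m (by omega) (fun r => 1 / ((1 + t) ^ 2 + r ^ 2) ^ (m + 1) * r ^ 2 * t ^ 4)]
      simp_rw [key t ht0.le]
      rw [integral_const_mul, scaled_int _ _ _ (by positivity)]
      have e : (1 + t) ^ (2 * (m+1)) = (1+t) ^ (m+1+1) * (1+t)^m := by ring
      rw [e]
      field_simp
  · apply Measurable.aestronglyMeasurable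
    fun_prop

lemma main_intble (m : ℕ) (hm : 6 ≤ m) :
    IntegrableOn (fun p : ℝ × EuclideanSpace ℝ (Fin m) =>
      (‖p.2‖ ^ 2 + p.1 ^ 2 - 1) / ((1 + p.1) ^ 2 + ‖p.2‖ ^ 2) ^ (m + 2) * ‖p.2‖ ^ 2 * p.1 ^ 4)
      ((Set.Ici (0:ℝ)) ×ˢ Set.univ) ((volume : Measure ℝ).prod volume) := by
  refine Integrable.mono' (dom_intble m hm) ?_ ?_
  · apply Measurable.aestronglyMeasurable
    fun_prop
  · filter_upwards [ae_restrict_mem (measurableSet_Ici.prod MeasurableSet.univ)] with p hp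
    have ht : (0:ℝ) ≤ p.1 := hp.1
    generalize p.1 = t at *
    generalize ‖p.2‖ = r at *
    have hpos : 0 < (1 + t) ^ 2 + r ^ 2 := by positivity
    rw [norm_mul, norm_mul, norm_div, Real.norm_of_nonneg (by positivity : 0 ≤ r ^ 2),
      Real.norm_of_nonneg (by positivity : 0 ≤ t ^ 4),
      Real.norm_of_nonneg (by positivity : 0 ≤ ((1 + t) ^ 2 + r ^ 2) ^ (m + 2))]
    gcongr ?_ * _ * _
    rw [div_le_div_iff₀ (by positivity) (by positivity), one_mul, pow_succ _ (m+1), mul_comm]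
    gcongr
    rw [Real.norm_eq_abs, abs_le]
    constructor <;> nlinarith [sq_nonneg r, sq_nonneg t]

lemma inner_int (m : ℕ) (hm : 6 ≤ m) (t : ℝ) (ht : 0 < t) :
    ∫ z : EuclideanSpace ℝ (Fin m),
      (‖z‖ ^ 2 + t ^ 2 - 1) / ((1 + t) ^ 2 + ‖z‖ ^ 2) ^ (m + 2) * ‖z‖ ^ 2 * t ^ 4
    = sphereArea m * (Iint (m+2) (m+3) * (t ^ 4 / (1 + t) ^ m)
      + Iint (m+2) (m+1) * (t ^ 5 / (1+t)^(m+1) - t ^ 4 / (1+t)^(m+1))) := by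
  rw [radial_int m (by omega)
    (fun r => (r ^ 2 + t ^ 2 - 1) / ((1 + t) ^ 2 + r ^ 2) ^ (m + 2) * r ^ 2 * t ^ 4)]
  congr 1
  have key : ∀ r : ℝ,
      r ^ (m-1) * ((r ^ 2 + t ^ 2 - 1) / ((1 + t) ^ 2 + r ^ 2) ^ (m + 2) * r ^ 2 * t ^ 4)
      = t ^ 4 * (r ^ (m+3) / ((1 + t) ^ 2 + r ^ 2) ^ (m + 2))
        + t ^ 4 * (t ^ 2 - 1) * (r ^ (m+1) / ((1 + t) ^ 2 + r ^ 2) ^ (m + 2)) := by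
    intro r
    obtain ⟨k, rfl⟩ : ∃ j, m = j + 1 := ⟨m - 1, by omega⟩
    simp only [add_tsub_cancel_right]
    ring
  simp_rw [key]
  rw [integral_add ((scaled_intOn (m+3) (m+2) (by omega) (1+t) (by positivity)).const_mul _)
    ((scaled_intOn (m+1) (m+2) (by omega) (1+t) (by positivity)).const_mul _),
    integral_const_mul, integral_const_mul, scaled_int _ _ _ (by positivity),
    scaled_int _ _ _ (by positivity)]
  have e : (1 + t) ^ (2 * (m+2)) = (1+t) ^ (m+4) * (1+t)^m := by ring
  rw [e]
  field_simp
  ring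

lemma final_arith (j : ℕ) :
    Iint (j+8) (j+9) * Jaux 4 (j+6) + Iint (j+8) (j+7) * (Jaux 5 (j+7) - Jaux 4 (j+7))
    = 144 / (((j:ℝ)+7) * ((j:ℝ)+5) * ((j:ℝ)+4) * ((j:ℝ)+3) * ((j:ℝ)+2) * ((j:ℝ)+1)) *
      Iint (j+7) (j+7) := by
  have a0 := Jaux_zero j
  have a1 := Jaux_succ 0 (j+2) (by omega)
  have a2 := Jaux_succ 1 (j+3) (by omega)
  have a3 := Jaux_succ 2 (j+4) (by omega)
  have a4 := Jaux_succ 3 (j+5) (by omega)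
  have a5 := Jaux_succ 4 (j+6) (by omega)
  have b0 := Jaux_zero (j+1)
  have b1 := Jaux_succ 0 (j+3) (by omega)
  have b2 := Jaux_succ 1 (j+4) (by omega)
  have b3 := Jaux_succ 2 (j+5) (by omega)
  have b4 := Jaux_succ 3 (j+6) (by omega)
  norm_num [add_assoc] at a0 a1 a2 a3 a4 a5 b0 b1 b2 b3 b4
  have r1 := Iint_add (j+7) (j+7) (by omega)
  have r2 := Iint_rec (j+7) (by omega)
  norm_num [add_assoc] at r1 r2
  have r3 : Iint (j+8) (j+9) = ((j:ℝ)+8) / (2 * ((j:ℝ)+7)) * Iint (j+7) (j+7) := by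
    field_simp; linarith
  have r4 : Iint (j+8) (j+7) = ((j:ℝ)+6) / (2 * ((j:ℝ)+7)) * Iint (j+7) (j+7) := by
    rw [r3] at r1
    rw [eq_sub_of_add_eq r1]
    field_simp; ring
  rw [r3, r4, a5, a4, a3, a2, a1, a0, b4, b3, b2, b1, b0]
  field_simp
  ring

lemma fubini_step (m : ℕ) (hm : 6 ≤ m) [NeZero (m+1)] :
    ∫ y in halfSpace (m+1), L1 (m+1) y * barNormSq (m+1) y * (lastCoord (m+1) y) ^ 4
    = ∫ t in Set.Ioi (0:ℝ), ∫ z : EuclideanSpace ℝ (Fin m),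
      (‖z‖ ^ 2 + t ^ 2 - 1) / ((1 + t) ^ 2 + ‖z‖ ^ 2) ^ (m + 2) * ‖z‖ ^ 2 * t ^ 4 := by
  rw [split_integral, setIntegral_prod _ (main_intble m hm), integral_Ici_eq_integral_Ioi]
  simp only [Measure.restrict_univ]

/-- `∫_{ℝⁿ₊} L₁ |ȳ|² yₙ⁴ dy = ω_{n-2} · 144/(n(n-2)(n-3)(n-4)(n-5)(n-6)) · Iₙⁿ`. -/
theorem statement11 (n : ℕ) [NeZero n] (hn : 7 ≤ n) :
    ∫ y in halfSpace n, L1 n y * barNormSq n y * (lastCoord n y) ^ 4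
      = sphereArea (n - 1)
          * (144 / ((n : ℝ) * ((n : ℝ) - 2) * ((n : ℝ) - 3) * ((n : ℝ) - 4)
              * ((n : ℝ) - 5) * ((n : ℝ) - 6)))
          * Iint n n := by
  obtain ⟨j, rfl⟩ : ∃ j, n = j + 6 + 1 := ⟨n - 7, by omega⟩
  rw [fubini_step (j+6) (by omega)]
  rw [setIntegral_congr_fun measurableSet_Ioi
    (fun t (ht : (0:ℝ) < t) => inner_int (j+6) (by omega) t ht), integral_const_mul]
  have i1 := (aux_intOn_J 4 (j+6) (by omega))
  have i2 := (aux_intOn_J 5 (j+6+1) (by omega))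
  have i3 := (aux_intOn_J 4 (j+6+1) (by omega))
  have i4 : IntegrableOn (fun s : ℝ => s ^ 5 / (1 + s) ^ (j+6+1) - s ^ 4 / (1 + s) ^ (j+6+1))
      (Set.Ioi 0) := i2.sub i3
  rw [integral_add (i1.const_mul _) (i4.const_mul _), integral_const_mul,
    integral_const_mul, integral_sub i2 i3, mul_assoc]
  have := final_arith j
  simp only [Jaux] at this
  rw [add_tsub_cancel_right, this]
  push_cast
  congr 3
  ring
end
end

section
/- Let n ≥ 7 and set L₂(y) := (|y|² - 1)/[(1+yₙ)² + |ȳ|²]^{n} for y = (ȳ, yₙ) ∈ ℝⁿ₊. Then ∫_{ℝⁿ₊} L₂(y)·|ȳ|²·yₙ² dy = ω_{n-2}·20/((n-3)(n-4)(n-5)(n-6))·Iₙⁿ. -/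
open MeasureTheory

noncomputable section

open Set Filter Topology

/-- Integrability of the radial profile. -/
lemma aux_integrable_s12 (m α : ℕ) (h : α + 2 ≤ 2 * m) :
    IntegrableOn (fun s : ℝ => s ^ α / (1 + s ^ 2) ^ m) (Ioi 0) := by
  have hb : IntegrableOn (fun s : ℝ => (1 + s ^ 2)⁻¹) (Ioi 0) :=
    integrable_inv_one_add_sq.integrableOn
  refine Integrable.mono' hb ?_ ?_
  · apply Continuous.aestronglyMeasurable
    refine Continuous.div (by fun_prop) (by fun_prop) (fun s => by positivity)
  · filter_upwards [ae_restrict_mem measurableSet_Ioi] with s hs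
    have hs : (0 : ℝ) < s := hs
    rw [Real.norm_of_nonneg (by positivity), div_le_iff₀ (by positivity)]
    obtain ⟨k, rfl⟩ : ∃ k, m = k + 1 := ⟨m - 1, by omega⟩
    have e : (1 + s ^ 2)⁻¹ * (1 + s ^ 2) ^ (k + 1) = (1 + s ^ 2) ^ k := by
      field_simp; ring
    rw [e]
    set q := Real.sqrt (1 + s ^ 2) with hq
    have hq2 : q ^ 2 = 1 + s ^ 2 := Real.sq_sqrt (by positivity)
    have hq1 : 1 ≤ q := by rw [hq]; exact Real.one_le_sqrt.mpr (by nlinarith)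
    have hsq : s ≤ q := Real.le_sqrt_of_sq_le (by linarith)
    calc s ^ α ≤ q ^ α := pow_le_pow_left₀ hs.le hsq _
      _ ≤ q ^ (2 * k) := pow_le_pow_right₀ hq1 (by omega)
      _ = _ := by rw [pow_mul, hq2]

lemma aux_rec (N : ℕ) :
    ((N : ℝ) + 4) * Iint (N + 7) (N + 9) = ((N : ℝ) + 8) * Iint (N + 7) (N + 7) := by
  have h1 := aux_integrable_s12 (N + 7) (N + 9) (by omega)
  have h2 := aux_integrable_s12 (N + 7) (N + 7) (by omega)
  have key : ∫ s in Ioi (0 : ℝ), (((N : ℝ) + 8) * (s ^ (N + 7) / (1 + s ^ 2) ^ (N + 7))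
      - ((N : ℝ) + 4) * (s ^ (N + 9) / (1 + s ^ 2) ^ (N + 7))) = 0 - 0 := by
    have := integral_Ioi_of_hasDerivAt_of_tendsto' (a := (0 : ℝ)) (m := 0)
      (f := fun s : ℝ => s ^ (N + 8) / (1 + s ^ 2) ^ (N + 6))
      (f' := fun s : ℝ => ((N : ℝ) + 8) * (s ^ (N + 7) / (1 + s ^ 2) ^ (N + 7))
      - ((N : ℝ) + 4) * (s ^ (N + 9) / (1 + s ^ 2) ^ (N + 7))) ?_ ?_ ?_
    · simpa using this
    · intro x _
      have hx : (1 + x ^ 2) ≠ 0 := by positivity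
      have := (hasDerivAt_pow (N + 8) x).div
        (((hasDerivAt_pow 2 x).const_add 1).pow (N + 6)) (pow_ne_zero _ hx)
      refine HasDerivAt.congr_deriv this ?_
      simp only [Pi.pow_apply]
      have e1 : N + 8 - 1 = N + 7 := by omega
      have e2 : N + 6 - 1 = N + 5 := by omega
      rw [e1, e2]
      push_cast
      field_simp
      ring
    · exact (h2.const_mul _).sub (h1.const_mul _)
    · refine squeeze_zero' (g := fun x : ℝ => x⁻¹) ?_ ?_ tendsto_inv_atTop_zero
      · filter_upwards [eventually_gt_atTop 0] with x hx
        positivity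
      · filter_upwards [eventually_ge_atTop 1] with x hx
        have hx0 : 0 < x := by linarith
        rw [div_le_iff₀ (by positivity)]
        calc x ^ (N + 8) ≤ x ^ (2 * N + 11) := pow_le_pow_right₀ hx (by omega)
          _ = x⁻¹ * (x ^ 2) ^ (N + 6) := by
            rw [← pow_mul, show 2 * (N + 6) = 2 * N + 11 + 1 by ring, pow_succ]
            field_simp
            ring
          _ ≤ x⁻¹ * (1 + x ^ 2) ^ (N + 6) := by gcongr; linarith
  rw [integral_sub (h2.const_mul _) (h1.const_mul _), integral_const_mul, integral_const_mul] at key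
  unfold Iint
  linarith

/-- `∫ (1+t)^{-(p+2)} = 1/(p+1)`. -/
lemma aux_base (p : ℕ) :
    IntegrableOn (fun t : ℝ => 1 / (1 + t) ^ (p + 2)) (Ioi 0) ∧
    ∫ t in Ioi (0 : ℝ), 1 / (1 + t) ^ (p + 2) = 1 / ((p : ℝ) + 1) := by
  have hd : ∀ x ∈ Ici (0 : ℝ), HasDerivAt (fun t : ℝ => -(1 / ((p : ℝ) + 1)) * ((1 + t) ^ (p + 1))⁻¹)
      (1 / (1 + x) ^ (p + 2)) x := by
    intro x hx
    have hx : (0 : ℝ) ≤ x := hx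
    have h1 : (1 + x) ≠ 0 := by positivity
    have := ((((hasDerivAt_id x).const_add 1).pow (p + 1)).inv (pow_ne_zero _ h1)).const_mul
      (-(1 / ((p : ℝ) + 1)))
    refine HasDerivAt.congr_deriv this ?_
    simp only [Pi.pow_apply, id, Nat.add_sub_cancel]
    push_cast
    field_simp
    ring
  have ht : Tendsto (fun t : ℝ => -(1 / ((p : ℝ) + 1)) * ((1 + t) ^ (p + 1))⁻¹) atTop (𝓝 0) := by
    have : Tendsto (fun t : ℝ => ((1 + t) ^ (p + 1))⁻¹) atTop (𝓝 0) :=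
      tendsto_inv_atTop_zero.comp
        ((tendsto_pow_atTop (by omega)).comp (tendsto_atTop_add_const_left _ 1 tendsto_id))
    simpa using this.const_mul (-(1 / ((p : ℝ) + 1)))
  have hi : IntegrableOn (fun t : ℝ => 1 / (1 + t) ^ (p + 2)) (Ioi 0) :=
    integrableOn_Ioi_deriv_of_nonneg' hd (fun x hx => by
      have hx : (0 : ℝ) < x := hx
      positivity) ht
  refine ⟨hi, ?_⟩
  rw [integral_Ioi_of_hasDerivAt_of_tendsto' hd hi ht]
  simp

/-- `∫ t² (1+t)^{-(p+4)}`. -/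
lemma aux_t2 (p : ℕ) :
    IntegrableOn (fun t : ℝ => t ^ 2 / (1 + t) ^ (p + 4)) (Ioi 0) ∧
    ∫ t in Ioi (0 : ℝ), t ^ 2 / (1 + t) ^ (p + 4)
      = 2 / (((p : ℝ) + 1) * ((p : ℝ) + 2) * ((p : ℝ) + 3)) := by
  obtain ⟨i0, v0⟩ := aux_base p
  obtain ⟨i1, v1⟩ := aux_base (p + 1)
  obtain ⟨i2, v2⟩ := aux_base (p + 2)
  have he : EqOn (fun t : ℝ => 1 / (1 + t) ^ (p + 2) - 2 * (1 / (1 + t) ^ (p + 1 + 2))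
      + 1 / (1 + t) ^ (p + 2 + 2)) (fun t : ℝ => t ^ 2 / (1 + t) ^ (p + 4)) (Ioi 0) := by
    intro t ht
    have ht : (0 : ℝ) < t := ht
    simp only
    field_simp
    ring
  have h01 : IntegrableOn (fun t : ℝ => 1 / (1 + t) ^ (p + 2)
      - 2 * (1 / (1 + t) ^ (p + 1 + 2))) (Ioi 0) := i0.sub (i1.const_mul 2)
  have hi := h01.add i2
  refine ⟨hi.congr_fun he measurableSet_Ioi, ?_⟩
  rw [← setIntegral_congr_fun measurableSet_Ioi he, integral_add h01 i2,
    integral_sub i0 (i1.const_mul 2), integral_const_mul, v0, v1, v2]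
  push_cast
  field_simp
  ring

/-- The slice integral. -/
lemma aux_slice (N a b : ℕ) (hab : a + b = 8) (hb : 4 ≤ b) (c : ℝ) (hc : 0 < c) :
    Integrable (fun x : EuclideanSpace ℝ (Fin (N + 6)) => ‖x‖ ^ a / (c ^ 2 + ‖x‖ ^ 2) ^ (N + 7)) ∧
    ∫ x : EuclideanSpace ℝ (Fin (N + 6)), ‖x‖ ^ a / (c ^ 2 + ‖x‖ ^ 2) ^ (N + 7)
      = sphereArea (N + 6) * Iint (N + 7) (N + 5 + a) / c ^ (N + b) := by
  set g : ℝ → ℝ := fun r => r ^ (N + 5 + a) / (c ^ 2 + r ^ 2) ^ (N + 7) with hg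
  have hg1 : ∀ s, g (c * s)
      = (c ^ (N + b + 1))⁻¹ * (s ^ (N + 5 + a) / (1 + s ^ 2) ^ (N + 7)) := by
    intro s
    have : c ^ 2 + (c * s) ^ 2 = c ^ 2 * (1 + s ^ 2) := by ring
    have e : (c ^ 2) ^ (N + 7) = c ^ (N + 5 + a) * c ^ (N + b + 1) := by
      rw [← pow_mul, ← pow_add]; congr 1; omega
    simp only [hg]
    rw [this, mul_pow, mul_pow, e]
    field_simp
  have hi0 := aux_integrable_s12 (N + 7) (N + 5 + a) (by omega)
  have hgi : IntegrableOn g (Ioi 0) := by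
    have := (integrableOn_Ioi_comp_mul_left_iff g 0 hc).1
      (by simp only [hg1]; exact hi0.const_mul _)
    simpa using this
  have hgv : ∫ r in Ioi (0 : ℝ), g r = Iint (N + 7) (N + 5 + a) / c ^ (N + b) := by
    have := integral_comp_mul_left_Ioi' g 0 hc
    rw [mul_zero] at this
    rw [← this]
    simp only [hg1, integral_const_mul, smul_eq_mul]
    unfold Iint
    rw [pow_succ]
    field_simp
  have hgf : (fun y : ℝ => y ^ (Module.finrank ℝ (EuclideanSpace ℝ (Fin (N + 6))) - 1) •
      (y ^ a / (c ^ 2 + y ^ 2) ^ (N + 7))) = g := by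
    funext y
    simp only [finrank_euclideanSpace, Fintype.card_fin, hg, smul_eq_mul]
    rw [show N + 6 - 1 = N + 5 by omega, pow_add y (N + 5) a]
    ring
  constructor
  · have := (integrable_fun_norm_addHaar (volume : Measure (EuclideanSpace ℝ (Fin (N + 6))))
      (f := fun y : ℝ => y ^ a / (c ^ 2 + y ^ 2) ^ (N + 7))).2
    rw [hgf] at this
    exact this hgi
  · have := integral_fun_norm_addHaar (volume : Measure (EuclideanSpace ℝ (Fin (N + 6))))
      (fun y : ℝ => y ^ a / (c ^ 2 + y ^ 2) ^ (N + 7))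
    rw [hgf, hgv] at this
    rw [this]
    simp only [finrank_euclideanSpace, Fintype.card_fin, sphereArea, nsmul_eq_mul, smul_eq_mul,
      Measure.real]
    ring

/-- Fubini for one term. -/
lemma aux_fubini (N a b : ℕ) (hab : a + b = 8) (hb : 4 ≤ b) (w : ℝ → ℝ) (hw : Continuous w)
    (hwi : IntegrableOn (fun t => w t / (1 + t) ^ (N + b)) (Ioi 0)) :
    Integrable (fun z : ℝ × EuclideanSpace ℝ (Fin (N + 6)) =>
      w z.1 * (‖z.2‖ ^ a / ((1 + z.1) ^ 2 + ‖z.2‖ ^ 2) ^ (N + 7)))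
      ((volume.restrict (Ioi 0)).prod volume) ∧
    ∫ z : ℝ × EuclideanSpace ℝ (Fin (N + 6)),
      w z.1 * (‖z.2‖ ^ a / ((1 + z.1) ^ 2 + ‖z.2‖ ^ 2) ^ (N + 7))
      ∂((volume.restrict (Ioi 0)).prod volume)
      = sphereArea (N + 6) * Iint (N + 7) (N + 5 + a) *
        ∫ t in Ioi (0 : ℝ), w t / (1 + t) ^ (N + b) := by
  have hI : Integrable (fun z : ℝ × EuclideanSpace ℝ (Fin (N + 6)) =>
      w z.1 * (‖z.2‖ ^ a / ((1 + z.1) ^ 2 + ‖z.2‖ ^ 2) ^ (N + 7)))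
      ((volume.restrict (Ioi 0)).prod volume) := by
    rw [integrable_prod_iff]
    · constructor
      · filter_upwards [ae_restrict_mem measurableSet_Ioi] with t ht
        have ht : (0 : ℝ) < t := ht
        exact (aux_slice N a b hab hb (1 + t) (by positivity)).1.const_mul _
      · have h := (hwi.norm).const_mul (sphereArea (N + 6) * Iint (N + 7) (N + 5 + a))
        refine IntegrableOn.congr_fun h ?_ measurableSet_Ioi
        intro t ht
        have ht : (0 : ℝ) < t := ht
        have : ∀ y : EuclideanSpace ℝ (Fin (N + 6)),
            ‖w t * (‖y‖ ^ a / ((1 + t) ^ 2 + ‖y‖ ^ 2) ^ (N + 7))‖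
            = ‖w t‖ * (‖y‖ ^ a / ((1 + t) ^ 2 + ‖y‖ ^ 2) ^ (N + 7)) := by
          intro y
          rw [norm_mul, Real.norm_of_nonneg
            (by positivity : 0 ≤ ‖y‖ ^ a / ((1 + t) ^ 2 + ‖y‖ ^ 2) ^ (N + 7))]
        simp only [this, integral_const_mul]
        rw [(aux_slice N a b hab hb (1 + t) (by positivity)).2, norm_div,
          Real.norm_of_nonneg (by positivity : 0 ≤ (1 + t) ^ (N + b))]
        ring
    · apply Measurable.aestronglyMeasurable
      have := hw.measurable
      fun_prop
  refine ⟨hI, ?_⟩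
  rw [integral_prod _ hI, ← integral_const_mul]
  refine setIntegral_congr_fun measurableSet_Ioi ?_
  intro t ht
  have ht : (0 : ℝ) < t := ht
  simp only [integral_const_mul]
  rw [(aux_slice N a b hab hb (1 + t) (by positivity)).2]
  ring

/-- Splitting off the last coordinate. -/
def aux_split_s12 (m : ℕ) :
    EuclideanSpace ℝ (Fin (m + 1)) ≃ᵐ ℝ × EuclideanSpace ℝ (Fin m) :=
  ((MeasurableEquiv.toLp 2 (Fin (m + 1) → ℝ)).symm.trans
    (MeasurableEquiv.piFinSuccAbove (fun _ => ℝ) (Fin.last m))).trans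
    (MeasurableEquiv.prodCongr (MeasurableEquiv.refl ℝ) (MeasurableEquiv.toLp 2 (Fin m → ℝ)))

lemma aux_split_fst (m : ℕ) (y : EuclideanSpace ℝ (Fin (m + 1))) :
    (aux_split_s12 m y).1 = y (Fin.last m) := rfl

lemma aux_split_snd (m : ℕ) (y : EuclideanSpace ℝ (Fin (m + 1))) (j : Fin m) :
    (aux_split_s12 m y).2 j = y (Fin.castSucc j) := by
  have : (aux_split_s12 m y).2 j = y ((Fin.last m).succAbove j) := rfl
  rw [this, Fin.succAbove_last]

lemma aux_split_mp (m : ℕ) : MeasurePreserving (aux_split_s12 m) volume (volume.prod volume) := by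
  have h1 := EuclideanSpace.volume_preserving_symm_measurableEquiv_toLp (Fin (m + 1))
  have h2 := volume_preserving_piFinSuccAbove (fun _ : Fin (m + 1) => ℝ) (Fin.last m)
  have h3 : MeasurePreserving (Prod.map id (MeasurableEquiv.toLp 2 (Fin m → ℝ)))
      ((volume : Measure ℝ).prod (volume : Measure (Fin m → ℝ))) (volume.prod volume) :=
    (MeasurePreserving.id volume).prod (PiLp.volume_preserving_toLp (Fin m))
  exact h3.comp (h2.comp h1)

/-- `∫_{ℝⁿ₊} L₂ |ȳ|² yₙ² dy = ω_{n-2} · 20/((n-3)(n-4)(n-5)(n-6)) · Iₙⁿ`. -/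
theorem statement12 (n : ℕ) [NeZero n] (hn : 7 ≤ n) :
    ∫ y in halfSpace n, L2 n y * barNormSq n y * (lastCoord n y) ^ 2
      = sphereArea (n - 1)
          * (20 / (((n : ℝ) - 3) * ((n : ℝ) - 4) * ((n : ℝ) - 5) * ((n : ℝ) - 6)))
          * Iint n n := by
  obtain ⟨N, rfl⟩ : ∃ N, n = N + 7 := ⟨n - 7, by omega⟩
  have hl : ∀ y, lastCoord (N + 7) y = (aux_split_s12 (N + 6) y).1 := fun y => rfl
  have hbar : ∀ y, barNormSq (N + 7) y = ‖(aux_split_s12 (N + 6) y).2‖ ^ 2 := by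
    intro y
    rw [EuclideanSpace.real_norm_sq_eq]
    unfold barNormSq
    rw [Fin.sum_univ_castSucc]
    simp [aux_split_snd]
  have hnorm : ∀ y : EuclideanSpace ℝ (Fin (N + 7)),
      ‖y‖ ^ 2 = ‖(aux_split_s12 (N + 6) y).2‖ ^ 2 + (aux_split_s12 (N + 6) y).1 ^ 2 := by
    intro y
    rw [EuclideanSpace.real_norm_sq_eq, EuclideanSpace.real_norm_sq_eq, Fin.sum_univ_castSucc]
    simp [aux_split_snd, aux_split_fst]
  set F : ℝ × EuclideanSpace ℝ (Fin (N + 6)) → ℝ := fun z =>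
    (‖z.2‖ ^ 2 + z.1 ^ 2 - 1) / ((1 + z.1) ^ 2 + ‖z.2‖ ^ 2) ^ (N + 7) * ‖z.2‖ ^ 2 * z.1 ^ 2 with hF
  have hs : halfSpace (N + 7) = aux_split_s12 (N + 6) ⁻¹' (Ici 0 ×ˢ univ) := by
    ext y
    simp [halfSpace, hl]
  have h1 : ∫ y in halfSpace (N + 7), L2 (N + 7) y * barNormSq (N + 7) y * (lastCoord (N + 7) y) ^ 2
      = ∫ z, F z ∂((volume.restrict (Ioi (0 : ℝ))).prod volume) := by
    have := (aux_split_mp (N + 6)).setIntegral_preimage_emb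
      (aux_split_s12 (N + 6)).measurableEmbedding F (Ici 0 ×ˢ univ)
    rw [← hs, ← Measure.prod_restrict, Measure.restrict_univ,
      restrict_Ioi_eq_restrict_Ici.symm] at this
    rw [← this]
    simp only [L2, hl, hbar, hnorm, hF]
  rw [h1]
  obtain ⟨i4, v4⟩ := aux_t2 N
  obtain ⟨i5, v5⟩ := aux_t2 (N + 1)
  have he : EqOn (fun t : ℝ => t ^ 2 / (1 + t) ^ (N + 4) - 2 * (t ^ 2 / (1 + t) ^ (N + 1 + 4)))
      (fun t : ℝ => (t ^ 2 * (t ^ 2 - 1)) / (1 + t) ^ (N + 6)) (Ioi 0) := by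
    intro t ht
    have ht : (0 : ℝ) < t := ht
    simp only
    field_simp
    ring
  have i6 := IntegrableOn.congr_fun (i4.sub (i5.const_mul 2)) he measurableSet_Ioi
  have v6 := setIntegral_congr_fun (μ := volume) measurableSet_Ioi he
  rw [integral_sub i4 (i5.const_mul 2), integral_const_mul, v4, v5] at v6
  obtain ⟨f4, w4⟩ := aux_fubini N 4 4 rfl le_rfl (fun t => t ^ 2) (by fun_prop) i4
  obtain ⟨f2, w2⟩ := aux_fubini N 2 6 rfl (by norm_num) (fun t => t ^ 2 * (t ^ 2 - 1))
    (by fun_prop) i6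
  have hF2 : F = fun z => z.1 ^ 2 * (‖z.2‖ ^ 4 / ((1 + z.1) ^ 2 + ‖z.2‖ ^ 2) ^ (N + 7))
      + z.1 ^ 2 * (z.1 ^ 2 - 1) * (‖z.2‖ ^ 2 / ((1 + z.1) ^ 2 + ‖z.2‖ ^ 2) ^ (N + 7)) := by
    funext z
    simp only [hF]
    ring
  rw [hF2, integral_add f4 f2, w4, w2, v4, ← v6]
  have hr := aux_rec N
  have hr' : Iint (N + 7) (N + 9) = ((N : ℝ) + 8) / ((N : ℝ) + 4) * Iint (N + 7) (N + 7) := by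
    field_simp
    linarith
  rw [show N + 5 + 4 = N + 9 by ring, show N + 5 + 2 = N + 7 by ring, hr',
    show N + 7 - 1 = N + 6 by omega]
  push_cast
  rw [show (N : ℝ) + 7 - 3 = N + 4 by ring, show (N : ℝ) + 7 - 4 = N + 3 by ring,
    show (N : ℝ) + 7 - 5 = N + 2 by ring, show (N : ℝ) + 7 - 6 = N + 1 by ring]
  field_simp
  ring
end
end
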